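/- arXiv:2409.03128 — 2 statements merged into one kernel-verified Lean document; each statement's English description precedes it below -/
import Mathlib

section
/- (Rudnev–Shkredov–Stevens, prime field case) There exist constants C > 0 and c ≥ 0 such that for every prime p and every set A ⊆ 𝔽_p with 2 ≤ |A| ≤ p^{5/8}, there is a subset A' ⊆ A with |A'| ≥ |A|/2 and min{E⁺(A'), Eˣ(A')} ≤ C · |A|^{3 − 1/5} · (log |A|)^{c}. -/
/-- The additive energy of a finite set: the number of quadruples
`(a, b, a', b') ∈ A⁴` with `a + b = a' + b'`. -/
noncomputable def addEnergy {α : Type*} [Add α] [DecidableEq α] (A : Finset α) : ℕ :=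
  ((A ×ˢ A ×ˢ A ×ˢ A).filter (fun x => x.1 + x.2.1 = x.2.2.1 + x.2.2.2)).card

/-- The multiplicative energy of a finite set: the number of quadruples
`(a, b, a', b') ∈ A⁴` with `a · b = a' · b'`. -/
noncomputable def mulEnergy {α : Type*} [Mul α] [DecidableEq α] (A : Finset α) : ℕ :=
  ((A ×ˢ A ×ˢ A ×ˢ A).filter (fun x => x.1 * x.2.1 = x.2.2.1 * x.2.2.2)).card

/-! ### Polynomials in three variables and null lines -/

open MvPolynomial in
theorem six_mul_finrank_restrictTotalDegree (K : Type*) [Field K] (D : ℕ) :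
    6 * Module.finrank K (restrictTotalDegree (Fin 3) K D) = (D + 1) * (D + 2) * (D + 3) := by
  classical
  set S : Finset (Fin 3 →₀ ℕ) :=
    (Finset.range (D + 1)).biUnion fun k => (Finset.univ : Finset (Fin 3)).finsuppAntidiag k with hS
  have hset : {n : Fin 3 →₀ ℕ | (n.sum fun _ e => e) ≤ D} = (S : Set (Fin 3 →₀ ℕ)) := by
    ext n
    simp [hS, Finset.mem_finsuppAntidiag, Finsupp.sum_fintype]
  have hrank : Module.finrank K (restrictTotalDegree (Fin 3) K D) = S.card := by
    have := Module.finrank_eq_nat_card_basis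
      (basisRestrictSupport K {n : Fin 3 →₀ ℕ | (n.sum fun _ e => e) ≤ D})
    refine (show _ = _ from this).trans ?_
    rw [hset]
    simp
  have hcard : S.card = ∑ k ∈ Finset.range (D + 1), (k + 2).choose 2 := by
    rw [hS, Finset.card_biUnion]
    · refine Finset.sum_congr rfl fun k _ => ?_
      rw [Finset.card_finsuppAntidiag_nat_eq_choose]
      simp only [Finset.card_univ, Fintype.card_fin]
      rw [show 3 + k - 1 = k + 2 by omega, Nat.choose_symm_add]
    · intro i _ j _ hij
      rw [Function.onFun, Finset.disjoint_left]
      intro n hn hn'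
      rw [Finset.mem_finsuppAntidiag] at hn hn'
      exact hij (hn.1.symm.trans hn'.1)
  rw [hrank, hcard]
  clear hrank hcard hset hS S
  induction D with
  | zero => rfl
  | succ D ih =>
    rw [Finset.sum_range_succ, mul_add, ih]
    have h : 2 * (D + 1 + 2).choose 2 = (D + 3) * (D + 2) := by
      have := Nat.triangle_succ (D + 2)
      rw [Nat.choose_two_right]
      have h2 : 2 ∣ (D + 1 + 2) * (D + 1 + 2 - 1) := (Nat.even_mul_pred_self _).two_dvd
      rw [Nat.mul_div_cancel' h2]
      rfl
    nlinarith

section NullLines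

variable {K : Type*} [Field K]

/-- The point with first coordinate `x` on the null line with parameters `(t, u, v)`, that is,
the line `{(x, u + t x, v + t² x)}`. -/
def nullPoint (l : K × K × K) (x : K) : Fin 3 → K :=
  ![x, l.2.1 + l.1 * x, l.2.2 + l.1 ^ 2 * x]

/-- Restriction of a polynomial to a null line, parametrized by the first coordinate. -/
noncomputable def restrictLine (l : K × K × K) : MvPolynomial (Fin 3) K →ₐ[K] Polynomial K :=
  MvPolynomial.aeval ![Polynomial.X, Polynomial.C l.2.1 + Polynomial.C l.1 * Polynomial.X,
    Polynomial.C l.2.2 + Polynomial.C (l.1 ^ 2) * Polynomial.X]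

theorem eval_restrictLine (l : K × K × K) (f : MvPolynomial (Fin 3) K) (x : K) :
    (restrictLine l f).eval x = MvPolynomial.eval (nullPoint l x) f := by
  induction f using MvPolynomial.induction_on with
  | C a => simp [restrictLine]
  | add p q hp hq => simp [hp, hq]
  | mul_X p i hp =>
    rw [map_mul, map_mul, Polynomial.eval_mul, hp]
    congr 1
    fin_cases i <;> simp [restrictLine, nullPoint]

theorem natDegree_restrictLine_le (l : K × K × K) (f : MvPolynomial (Fin 3) K) :
    (restrictLine l f).natDegree ≤ f.totalDegree := by
  have := MvPolynomial.aeval_natDegree_le (n := 1) f le_rfl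
    ![Polynomial.X, Polynomial.C l.2.1 + Polynomial.C l.1 * Polynomial.X,
      Polynomial.C l.2.2 + Polynomial.C (l.1 ^ 2) * Polynomial.X] (by
    intro i
    fin_cases i
    · simp
    · simp only [Fin.mk_one, Matrix.cons_val_one, Matrix.cons_val_zero]
      compute_degree
    · simp only [Fin.reduceFinMk, Matrix.cons_val]
      compute_degree)
  simpa [restrictLine] using this

/-- A polynomial that vanishes at more points of a null line than its degree vanishes on it. -/
theorem restrictLine_eq_zero_of_card_lt {l : K × K × K} {f : MvPolynomial (Fin 3) K}
    {s : Finset K} (hs : ∀ x ∈ s, MvPolynomial.eval (nullPoint l x) f = 0)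
    (hc : f.totalDegree < s.card) : restrictLine l f = 0 := by
  refine Polynomial.eq_zero_of_natDegree_lt_card_of_eval_eq_zero' _ s ?_
    ((natDegree_restrictLine_le l f).trans_lt hc)
  intro x hx
  rw [eval_restrictLine, hs x hx]

/-- A nonzero polynomial of small degree vanishing on given null lines. -/
theorem exists_restrictLine_eq_zero (S : Finset (K × K × K)) {D : ℕ}
    (hD : 6 * S.card < (D + 1) ^ 2) :
    ∃ f : MvPolynomial (Fin 3) K, f ≠ 0 ∧ f.totalDegree ≤ D ∧ ∀ l ∈ S, restrictLine l f = 0 := by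
  classical
  let V := MvPolynomial.restrictTotalDegree (Fin 3) K D
  let φ : V →ₗ[K] (S → Polynomial.degreeLT K (D + 1)) := LinearMap.pi fun l =>
    ((restrictLine l.1).toLinearMap.comp V.subtype).codRestrict _ (by
      intro f
      rw [Polynomial.mem_degreeLT]
      refine Polynomial.degree_le_natDegree.trans_lt ?_
      exact_mod_cast Nat.lt_succ_of_le ((natDegree_restrictLine_le _ _).trans
        ((MvPolynomial.mem_restrictTotalDegree _ _ _).1 f.2)))
  have hlt : Module.finrank K (S → Polynomial.degreeLT K (D + 1)) < Module.finrank K V := by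
    rw [Module.finrank_pi_fintype]
    simp only [(Polynomial.degreeLTEquiv K (D + 1)).finrank_eq, Module.finrank_fin_fun,
      Finset.sum_const, Finset.card_univ, Fintype.card_coe, smul_eq_mul]
    have := six_mul_finrank_restrictTotalDegree K D
    nlinarith
  obtain ⟨f, hf, hf0⟩ := Submodule.exists_mem_ne_zero_of_ne_bot
    (LinearMap.ker_ne_bot_of_finrank_lt (f := φ) hlt)
  refine ⟨f, by simpa using hf0, (MvPolynomial.mem_restrictTotalDegree _ _ _).1 f.2, ?_⟩
  intro l hl
  have := congrFun (LinearMap.mem_ker.1 hf) ⟨l, hl⟩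
  simpa [φ, Subtype.ext_iff] using this

end NullLines

section Bezout

variable {K : Type*} [Field K]

/-- Two distinct null lines are separated by a polynomial of degree at most one. -/
theorem exists_separating_linear_form {l l' : K × K × K} (h : l ≠ l') :
    ∃ a : MvPolynomial (Fin 3) K, a.totalDegree ≤ 1 ∧ restrictLine l' a = 0 ∧
      restrictLine l a ≠ 0 := by
  have key : ∀ i : Fin 3, ∀ r s : K,
      (MvPolynomial.X i - MvPolynomial.C r - MvPolynomial.C s * MvPolynomial.X 0 :
        MvPolynomial (Fin 3) K).totalDegree ≤ 1 := by
    intro i r s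
    refine (MvPolynomial.totalDegree_sub _ _).trans (max_le
      ((MvPolynomial.totalDegree_sub _ _).trans (max_le ?_ ?_)) ?_)
    · simp
    · simp
    · refine (MvPolynomial.totalDegree_mul _ _).trans ?_
      simp
  by_cases h1 : l.1 = l'.1 ∧ l.2.1 = l'.2.1
  · have h2 : l.2.2 ≠ l'.2.2 := fun h2 => h (Prod.ext h1.1 (Prod.ext h1.2 h2))
    refine ⟨_, key 2 l'.2.2 (l'.1 ^ 2), ?_, ?_⟩
    · simp [restrictLine]
    · intro h0
      have := congrArg (Polynomial.eval 0) h0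
      simp [restrictLine] at this
      exact h2 (sub_eq_zero.1 this)
  · refine ⟨_, key 1 l'.2.1 l'.1, ?_, ?_⟩
    · simp [restrictLine]
    · intro h0
      have e0 := congrArg (Polynomial.eval 0) h0
      have e1 := congrArg (Polynomial.eval 1) h0
      simp [restrictLine] at e0 e1
      have h2 : l.2.1 = l'.2.1 := sub_eq_zero.1 e0
      exact h1 ⟨by linear_combination e1 - e0, h2⟩

theorem exists_separating_product (S : Finset (K × K × K)) (l : K × K × K) (hl : l ∈ S) :
    ∃ a : MvPolynomial (Fin 3) K, a.totalDegree ≤ S.card - 1 ∧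
      (∀ l' ∈ S, l' ≠ l → restrictLine l' a = 0) ∧ restrictLine l a ≠ 0 := by
  classical
  choose! a ha using fun l' (h : l ≠ l') => exists_separating_linear_form h
  refine ⟨∏ l' ∈ S.erase l, a l', ?_, ?_, ?_⟩
  · refine (MvPolynomial.totalDegree_finsetProd _ _).trans ?_
    rw [← Finset.card_erase_of_mem hl]
    refine (Finset.sum_le_card_nsmul _ _ 1 ?_).trans (by simp)
    intro l' hl'
    exact (ha l' (Finset.ne_of_mem_erase hl').symm).1
  · intro l' hl' hne
    rw [map_prod]
    exact Finset.prod_eq_zero (Finset.mem_erase.2 ⟨hne, hl'⟩) (ha l' hne.symm).2.1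
  · rw [map_prod, Finset.prod_ne_zero_iff]
    intro l' hl'
    exact (ha l' (Finset.ne_of_mem_erase hl').symm).2.2

theorem totalDegree_aeval_X_le (p : Polynomial K) :
    (Polynomial.aeval (MvPolynomial.X 0 : MvPolynomial (Fin 3) K) p).totalDegree ≤
      p.natDegree := by
  rw [Polynomial.aeval_eq_sum_range]
  refine MvPolynomial.totalDegree_finsetSum_le ?_
  intro i hi
  refine (MvPolynomial.totalDegree_smul_le _ _).trans ?_
  rw [MvPolynomial.totalDegree_X_pow]
  exact Nat.lt_succ_iff.1 (Finset.mem_range.1 hi)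

theorem restrictLine_aeval_X (l : K × K × K) (p : Polynomial K) :
    restrictLine l (Polynomial.aeval (MvPolynomial.X 0 : MvPolynomial (Fin 3) K) p) = p := by
  rw [← Polynomial.aeval_algHom_apply]
  simp [restrictLine]

open MvPolynomial in
/-- The dimension count behind the bound on the number of common null lines. -/
theorem card_mul_add_finrank_le {f g : MvPolynomial (Fin 3) K} (hf : Irreducible f)
    (hfg : ¬ f ∣ g) (S : Finset (K × K × K)) (hSf : ∀ l ∈ S, restrictLine l f = 0)
    (hSg : ∀ l ∈ S, restrictLine l g = 0) {D d e : ℕ} (hd : f.totalDegree = d)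
    (he : g.totalDegree = e) (hD : d + e + S.card ≤ D) :
    S.card * (D + 2 - S.card) + Module.finrank K (restrictTotalDegree (Fin 3) K (D - d)) +
      Module.finrank K (restrictTotalDegree (Fin 3) K (D - e)) ≤
    Module.finrank K (restrictTotalDegree (Fin 3) K D) +
      Module.finrank K (restrictTotalDegree (Fin 3) K (D - d - e)) := by
  classical
  have hf0 : f ≠ 0 := hf.ne_zero
  have hg0 : g ≠ 0 := fun h => hfg (h ▸ dvd_zero f)
  choose! a ha using exists_separating_product S
  let W := (S → Polynomial.degreeLT K (D + 2 - S.card)) ×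
    restrictTotalDegree (Fin 3) K (D - d) × restrictTotalDegree (Fin 3) K (D - e)
  let Ξ : W →ₗ[K] MvPolynomial (Fin 3) K :=
    (∑ i : S, (LinearMap.mulLeft K (a i)) ∘ₗ
      (Polynomial.aeval (X 0 : MvPolynomial (Fin 3) K)).toLinearMap ∘ₗ
        (Submodule.subtype _) ∘ₗ (LinearMap.proj i)).coprod
    ((LinearMap.mulLeft K f ∘ₗ Submodule.subtype _).coprod
      (LinearMap.mulLeft K g ∘ₗ Submodule.subtype _))
  have hΞ : ∀ w : W, Ξ w = ∑ i : S, a i * Polynomial.aeval (X 0) (w.1 i : Polynomial K) +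
      (f * w.2.1 + g * w.2.2) := by
    intro w
    simp only [Ξ]
    rw [LinearMap.coprod_apply, LinearMap.coprod_apply, LinearMap.sum_apply]
    rfl
  let Θ : restrictTotalDegree (Fin 3) K (D - d - e) →ₗ[K] W :=
    LinearMap.prod 0 (LinearMap.prod
      (-((LinearMap.mulLeft K g ∘ₗ Submodule.subtype _).codRestrict
        (restrictTotalDegree (Fin 3) K (D - d)) (by
          intro x
          have hx := (mem_restrictTotalDegree _ _ _).1 x.2
          rw [mem_restrictTotalDegree]
          refine (totalDegree_mul _ _).trans ?_
          simp only [Submodule.subtype_apply]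
          omega)))
      ((LinearMap.mulLeft K f ∘ₗ Submodule.subtype _).codRestrict
        (restrictTotalDegree (Fin 3) K (D - e)) (by
          intro x
          have hx := (mem_restrictTotalDegree _ _ _).1 x.2
          rw [mem_restrictTotalDegree]
          refine (totalDegree_mul _ _).trans ?_
          simp only [Submodule.subtype_apply]
          omega)))
  have hrange : LinearMap.range Ξ ≤ restrictTotalDegree (Fin 3) K D := by
    rintro _ ⟨w, rfl⟩
    rw [hΞ]
    refine Submodule.add_mem _ (Submodule.sum_mem _ fun i _ => ?_) (Submodule.add_mem _ ?_ ?_)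
    · rw [mem_restrictTotalDegree]
      refine (totalDegree_mul _ _).trans ?_
      have h1 := (ha i i.2).1
      have h2 := totalDegree_aeval_X_le (w.1 i : Polynomial K)
      have hpos : 0 < S.card := Finset.card_pos.2 ⟨i, i.2⟩
      have h3 : (w.1 i : Polynomial K).natDegree ≤ D + 2 - S.card - 1 := by
        have := (w.1 i).2
        rw [Polynomial.mem_degreeLT] at this
        rw [Polynomial.natDegree_le_iff_degree_le]
        by_cases h0 : (w.1 i : Polynomial K) = 0
        · simp [h0]
        · rw [Polynomial.degree_eq_natDegree h0] at this ⊢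
          have : (w.1 i : Polynomial K).natDegree < D + 2 - S.card := by exact_mod_cast this
          exact_mod_cast (by omega)
      omega
    · have hx := (mem_restrictTotalDegree _ _ _).1 w.2.1.2
      rw [mem_restrictTotalDegree]
      refine (totalDegree_mul _ _).trans ?_
      omega
    · have hx := (mem_restrictTotalDegree _ _ _).1 w.2.2.2
      rw [mem_restrictTotalDegree]
      refine (totalDegree_mul _ _).trans ?_
      omega
  have hker : LinearMap.ker Ξ ≤ LinearMap.range Θ := by
    intro w hw
    rw [LinearMap.mem_ker, hΞ] at hw
    have hp : ∀ i : S, (w.1 i : Polynomial K) = 0 := by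
      intro i
      have h := congrArg (restrictLine i.1) hw
      rw [map_add, map_add, map_mul, map_mul, hSf i i.2, hSg i i.2, map_sum,
        Finset.sum_eq_single i, map_mul, restrictLine_aeval_X] at h
      · simpa [(ha i i.2).2.2] using h
      · intro j _ hj
        rw [map_mul, (ha j j.2).2.1 i i.2 (fun h => hj (Subtype.ext h.symm)), zero_mul]
      · simp
    have hw' : f * w.2.1 + g * w.2.2 = 0 := by
      simpa [hp] using hw
    have hdvd : f ∣ g * w.2.2 := ⟨-w.2.1, by linear_combination hw'⟩
    obtain ⟨γ, hγ⟩ := (hf.prime.dvd_or_dvd hdvd).resolve_left hfg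
    have hγd : γ ∈ restrictTotalDegree (Fin 3) K (D - d - e) := by
      rw [mem_restrictTotalDegree]
      by_cases h0 : γ = 0
      · simp [h0]
      · have := (mem_restrictTotalDegree _ _ _).1 w.2.2.2
        rw [hγ, totalDegree_mul_of_isDomain hf0 h0] at this
        omega
    have h1 : (w.2.1 : MvPolynomial (Fin 3) K) = -(g * γ) := by
      have : f * (w.2.1 + g * γ) = 0 := by
        rw [hγ] at hw'
        linear_combination hw'
      have := (mul_eq_zero.1 this).resolve_left hf0
      linear_combination this
    refine ⟨⟨γ, hγd⟩, Prod.ext ?_ (Prod.ext ?_ ?_)⟩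
    · funext i
      exact Subtype.ext (hp i).symm
    · exact Subtype.ext h1.symm
    · exact Subtype.ext hγ.symm
  have hfinV : ∀ n, Module.Finite K (restrictTotalDegree (Fin 3) K n) := by
    intro n
    infer_instance
  have h1 := LinearMap.finrank_range_add_finrank_ker Ξ
  have h2 := (Submodule.finrank_mono hker).trans (LinearMap.finrank_range_le Θ)
  have h3 := Submodule.finrank_mono hrange
  have h4 : Module.finrank K W = S.card * (D + 2 - S.card) +
      (Module.finrank K (restrictTotalDegree (Fin 3) K (D - d)) +
      Module.finrank K (restrictTotalDegree (Fin 3) K (D - e))) := by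
    simp only [W]
    rw [Module.finrank_prod, Module.finrank_prod, Module.finrank_pi_fintype]
    simp [(Polynomial.degreeLTEquiv K (D + 2 - S.card)).finrank_eq]
  omega

/-- Bezout bound for the number of null lines in the intersection of two surfaces. -/
theorem card_le_totalDegree_mul {f g : MvPolynomial (Fin 3) K} (hf : Irreducible f)
    (hfg : ¬ f ∣ g) (S : Finset (K × K × K)) (hSf : ∀ l ∈ S, restrictLine l f = 0)
    (hSg : ∀ l ∈ S, restrictLine l g = 0) :
    S.card ≤ f.totalDegree * g.totalDegree := by
  obtain ⟨m, hm⟩ : ∃ m, m = S.card := ⟨_, rfl⟩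
  obtain ⟨d, hd⟩ : ∃ d, f.totalDegree = d := ⟨_, rfl⟩
  obtain ⟨e, he⟩ : ∃ e, g.totalDegree = e := ⟨_, rfl⟩
  obtain ⟨k, hk⟩ : ∃ k, k = m ^ 2 + 1 := ⟨_, rfl⟩
  have h := card_mul_add_finrank_le hf hfg S hSf hSg hd he (D := m + d + e + k) (by omega)
  have e1 := six_mul_finrank_restrictTotalDegree K (m + d + e + k)
  have e2 := six_mul_finrank_restrictTotalDegree K (m + d + e + k - d)
  have e3 := six_mul_finrank_restrictTotalDegree K (m + d + e + k - e)
  have e4 := six_mul_finrank_restrictTotalDegree K (m + d + e + k - d - e)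
  rw [hd, he, ← hm]
  rw [← hm, show m + d + e + k + 2 - m = d + e + k + 2 by omega] at h
  rw [show m + d + e + k - d = m + e + k by omega] at e2 h
  rw [show m + d + e + k - e = m + d + k by omega] at e3 h
  rw [show m + e + k - e = m + k by omega] at h
  rw [show m + d + e + k - d - e = m + k by omega] at e4
  by_contra hc
  have hc' : d * e + 1 ≤ m := by omega
  zify at *
  have : 6 * ((m:ℤ) * (d + e + k + 2)) + (m + e + k + 1) * (m + e + k + 2) * (m + e + k + 3) +
      (m + d + k + 1) * (m + d + k + 2) * (m + d + k + 3) ≤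
      (m + d + e + k + 1) * (m + d + e + k + 2) * (m + d + e + k + 3) +
      (m + k + 1) * (m + k + 2) * (m + k + 3) := by linarith
  have h2 : (2 * m * (d + e + k + 2) : ℤ) ≤ d * e * (2 * (m + k + 2) + d + e) := by
    nlinarith
  have h3 : (d * e * (2 * (m + k + 2) + d + e) : ℤ) ≤ (m - 1) * (2 * (m + k + 2) + d + e) := by
    apply mul_le_mul_of_nonneg_right (by linarith) (by positivity)
  have h4 : (0:ℤ) ≤ d ∧ (0:ℤ) ≤ e ∧ (0:ℤ) ≤ m := by omega
  nlinarith [mul_nonneg h4.2.2 h4.1, mul_nonneg h4.2.2 h4.2.1]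

end Bezout

section Derivatives

variable {K : Type*} [Field K]

open MvPolynomial in
theorem totalDegree_pderiv_le {f : MvPolynomial (Fin 3) K} (i : Fin 3) :
    (pderiv i f).totalDegree ≤ f.totalDegree - 1 := by
  classical
  refine Finset.sup_le fun m hm => ?_
  rw [mem_support_iff, coeff_pderiv] at hm
  have h := le_totalDegree (mem_support_iff.2 (left_ne_zero_of_mul hm))
  rw [Finsupp.sum_fintype _ _ (fun _ => rfl)] at h ⊢
  simp only [Finsupp.coe_add, Pi.add_apply, Finset.sum_add_distrib] at h
  have : ∑ j : Fin 3, (Finsupp.single i 1 : Fin 3 →₀ ℕ) j = 1 := by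
    simp [Finsupp.single_apply]
  omega

open MvPolynomial in
theorem pderiv_eq_zero_of_dvd {f : MvPolynomial (Fin 3) K} (hf : f.totalDegree ≠ 0) {i : Fin 3}
    (h : f ∣ pderiv i f) : pderiv i f = 0 := by
  by_contra h0
  have h1 := totalDegree_le_of_dvd_of_isDomain h h0
  have h2 := totalDegree_pderiv_le (f := f) i
  omega

open MvPolynomial in
/-- In characteristic `p`, a polynomial of degree less than `p` whose partial derivatives all vanish
is constant. -/
theorem totalDegree_eq_zero_of_pderiv_eq_zero {p : ℕ} [CharP K p] {f : MvPolynomial (Fin 3) K}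
    (hp : f.totalDegree < p) (h : ∀ i, pderiv i f = 0) : f.totalDegree = 0 := by
  classical
  rw [totalDegree_eq_zero_iff]
  intro m hm i
  by_contra hi
  have hs : m - Finsupp.single i 1 + Finsupp.single i 1 = m :=
    tsub_add_cancel_of_le (by simpa using Nat.one_le_iff_ne_zero.2 hi)
  have h1 := congrArg (coeff (m - Finsupp.single i 1)) (h i)
  rw [coeff_pderiv, hs, coeff_zero] at h1
  rcases mul_eq_zero.1 h1 with h2 | h2
  · exact (mem_support_iff.1 hm) h2
  · have h3 : ((m i : ℕ) : K) = 0 := by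
      have : m i = (m - (Finsupp.single i 1 : Fin 3 →₀ ℕ)) i + 1 := by
        conv_lhs => rw [← hs]
        simp
      rw [this]
      exact_mod_cast h2
    rw [CharP.cast_eq_zero_iff K p] at h3
    have h4 := Nat.le_of_dvd (Nat.pos_of_ne_zero hi) h3
    have h5 := le_totalDegree hm
    rw [Finsupp.sum_fintype _ _ (fun _ => rfl)] at h5
    have h6 := Finset.single_le_sum (f := fun j => m j) (fun _ _ => Nat.zero_le _)
      (Finset.mem_univ i)
    omega

open MvPolynomial in
theorem derivative_restrictLine (l : K × K × K) (f : MvPolynomial (Fin 3) K) :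
    Polynomial.derivative (restrictLine l f) = restrictLine l (pderiv 0 f) +
      Polynomial.C l.1 * restrictLine l (pderiv 1 f) +
      Polynomial.C (l.1 ^ 2) * restrictLine l (pderiv 2 f) := by
  induction f using MvPolynomial.induction_on with
  | C a => simp [restrictLine]
  | add p q hp hq =>
    simp only [map_add, hp, hq]
    ring
  | mul_X p i hp =>
    simp only [map_mul, Polynomial.derivative_mul, hp, pderiv_mul, map_add]
    have : Polynomial.derivative (restrictLine l (X i)) = restrictLine l (pderiv 0 (X i)) +
      Polynomial.C l.1 * restrictLine l (pderiv 1 (X i)) +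
      Polynomial.C (l.1 ^ 2) * restrictLine l (pderiv 2 (X i)) := by
      fin_cases i <;> simp [restrictLine, pderiv_X, -map_pow]
    rw [this]
    ring

/-- A polynomial solution of a second order linear equation with vanishing initial data is zero,
as long as its degree is less than the characteristic. -/
theorem eq_zero_of_second_order_equation {p : ℕ} [CharP K p] {φ γ A B : Polynomial K} {x : K}
    (hp : φ.natDegree < p)
    (h : γ * Polynomial.derivative (Polynomial.derivative φ) =
      A * Polynomial.derivative φ + B * φ)
    (hγ : γ.eval x ≠ 0) (h0 : φ.eval x = 0) (h1 : (Polynomial.derivative φ).eval x = 0) :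
    φ = 0 := by
  by_contra hφ
  obtain ⟨ψ, hψ, hnd⟩ := Polynomial.exists_eq_pow_rootMultiplicity_mul_and_not_dvd φ hφ x
  have hψx : ψ.eval x ≠ 0 := fun h => hnd (Polynomial.dvd_iff_isRoot.2 h)
  have hle : φ.rootMultiplicity x ≤ φ.natDegree := by
    have hdvd := Polynomial.natDegree_le_of_dvd (Polynomial.pow_rootMultiplicity_dvd φ x) hφ
    simpa using hdvd
  generalize φ.rootMultiplicity x = m at hψ hle
  have hd : ∀ n : ℕ, Polynomial.derivative ((Polynomial.X - Polynomial.C x) ^ (n + 1)) =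
      ((n + 1 : ℕ) : Polynomial K) * (Polynomial.X - Polynomial.C x) ^ n := by
    intro n
    rw [Polynomial.derivative_X_sub_C_pow, Nat.add_sub_cancel]
    simp
  rcases m with _ | _ | k
  · rw [hψ] at h0
    simp [hψx] at h0
  · rw [hψ] at h1
    simp [hψx] at h1
  · have e1 : Polynomial.derivative φ = (Polynomial.X - Polynomial.C x) ^ (k + 1) *
        (((k + 2 : ℕ) : Polynomial K) * ψ +
          (Polynomial.X - Polynomial.C x) * Polynomial.derivative ψ) := by
      rw [hψ, Polynomial.derivative_mul, hd]
      ring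
    have e2 : Polynomial.derivative (Polynomial.derivative φ) =
        (Polynomial.X - Polynomial.C x) ^ k * (((k + 1 : ℕ) : Polynomial K) *
          (((k + 2 : ℕ) : Polynomial K) * ψ +
          (Polynomial.X - Polynomial.C x) * Polynomial.derivative ψ) +
          (Polynomial.X - Polynomial.C x) * Polynomial.derivative
            (((k + 2 : ℕ) : Polynomial K) * ψ +
            (Polynomial.X - Polynomial.C x) * Polynomial.derivative ψ)) := by
      rw [e1, Polynomial.derivative_mul, hd]
      ring
    have hX : (Polynomial.X - Polynomial.C x) ^ k ≠ 0 :=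
      pow_ne_zero _ (Polynomial.X_sub_C_ne_zero x)
    have h3 : γ * (((k + 1 : ℕ) : Polynomial K) *
          (((k + 2 : ℕ) : Polynomial K) * ψ +
          (Polynomial.X - Polynomial.C x) * Polynomial.derivative ψ) +
          (Polynomial.X - Polynomial.C x) * Polynomial.derivative
            (((k + 2 : ℕ) : Polynomial K) * ψ +
            (Polynomial.X - Polynomial.C x) * Polynomial.derivative ψ)) =
        (Polynomial.X - Polynomial.C x) * (A * (((k + 2 : ℕ) : Polynomial K) * ψ +
          (Polynomial.X - Polynomial.C x) * Polynomial.derivative ψ) +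
          B * (Polynomial.X - Polynomial.C x) * ψ) := by
      apply mul_left_cancel₀ hX
      rw [e2, e1] at h
      linear_combination h + B * hψ
    have h4 := congrArg (Polynomial.eval x) h3
    simp only [Polynomial.eval_mul, Polynomial.eval_add, Polynomial.eval_natCast,
      Polynomial.eval_sub, Polynomial.eval_X, Polynomial.eval_C, sub_self, zero_mul, add_zero] at h4
    have hc : ∀ n : ℕ, n + 1 ≤ φ.natDegree → ((n + 1 : ℕ) : K) ≠ 0 := by
      intro n hn h
      rw [CharP.cast_eq_zero_iff K p] at h
      have := Nat.le_of_dvd (Nat.succ_pos n) h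
      omega
    exact mul_ne_zero hγ (mul_ne_zero (hc k (by omega))
      (mul_ne_zero (hc (k + 1) (by omega)) hψx)) h4

end Derivatives

section SecondOrder

variable {K : Type*} [Field K]

open MvPolynomial

/-- The null line through a point with a given slope. -/
def lineThrough (q : Fin 3 → K) (t : K) : K × K × K :=
  (t, q 1 - t * q 0, q 2 - t ^ 2 * q 0)

theorem nullPoint_lineThrough (q : Fin 3 → K) (t : K) :
    nullPoint (lineThrough q t) (q 0) = q := by
  ext i
  fin_cases i <;> simp [nullPoint, lineThrough]

theorem lineThrough_nullPoint (l : K × K × K) (x : K) :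
    lineThrough (nullPoint l x) l.1 = l := by
  refine Prod.ext rfl (Prod.ext ?_ ?_) <;> simp [nullPoint, lineThrough]

/-- The coefficients of the second derivative of `f` in the direction `(1, t, t²)`, as a polynomial
in `t`. -/
noncomputable def secondDeriv (f : MvPolynomial (Fin 3) K) : Fin 5 → MvPolynomial (Fin 3) K :=
  ![pderiv 0 (pderiv 0 f), pderiv 1 (pderiv 0 f) + pderiv 0 (pderiv 1 f),
    pderiv 1 (pderiv 1 f) + pderiv 2 (pderiv 0 f) + pderiv 0 (pderiv 2 f),
    pderiv 2 (pderiv 1 f) + pderiv 1 (pderiv 2 f), pderiv 2 (pderiv 2 f)]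

theorem totalDegree_secondDeriv_le (f : MvPolynomial (Fin 3) K) (i : Fin 5) :
    (secondDeriv f i).totalDegree ≤ f.totalDegree := by
  have h : ∀ i j, (pderiv i (pderiv j f)).totalDegree ≤ f.totalDegree := fun i j =>
    (totalDegree_pderiv_le i).trans ((Nat.sub_le _ _).trans
      ((totalDegree_pderiv_le j).trans (Nat.sub_le _ _)))
  fin_cases i
  · exact h 0 0
  · exact (totalDegree_add _ _).trans (max_le (h _ _) (h _ _))
  · exact (totalDegree_add _ _).trans
      (max_le ((totalDegree_add _ _).trans (max_le (h _ _) (h _ _))) (h _ _))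
  · exact (totalDegree_add _ _).trans (max_le (h _ _) (h _ _))
  · exact h 2 2

theorem derivative_derivative_restrictLine (l : K × K × K) (f : MvPolynomial (Fin 3) K) :
    Polynomial.derivative (Polynomial.derivative (restrictLine l f)) =
      restrictLine l (secondDeriv f 0) + Polynomial.C l.1 * restrictLine l (secondDeriv f 1) +
      Polynomial.C l.1 ^ 2 * restrictLine l (secondDeriv f 2) +
      Polynomial.C l.1 ^ 3 * restrictLine l (secondDeriv f 3) +
      Polynomial.C l.1 ^ 4 * restrictLine l (secondDeriv f 4) := by
  rw [derivative_restrictLine]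
  simp only [map_add, Polynomial.derivative_mul, Polynomial.derivative_C, derivative_restrictLine,
    secondDeriv, Matrix.cons_val, map_pow]
  rw [← Polynomial.C_pow, Polynomial.derivative_C]
  simp only [Polynomial.C_pow]
  ring

/-- The linear coefficient of the remainder of the second directional derivative modulo the
first one. -/
noncomputable def remainderOne (f : MvPolynomial (Fin 3) K) : MvPolynomial (Fin 3) K :=
  pderiv 2 f * pderiv 2 f * pderiv 2 f * secondDeriv f 1 -
    pderiv 2 f * pderiv 2 f * pderiv 1 f * secondDeriv f 2 +
    pderiv 2 f * pderiv 1 f * pderiv 1 f * secondDeriv f 3 -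
    pderiv 2 f * pderiv 2 f * pderiv 0 f * secondDeriv f 3 +
    pderiv 0 f * pderiv 1 f * pderiv 2 f * secondDeriv f 4 +
    pderiv 0 f * pderiv 1 f * pderiv 2 f * secondDeriv f 4 -
    pderiv 1 f * pderiv 1 f * pderiv 1 f * secondDeriv f 4

/-- The constant coefficient of the remainder of the second directional derivative modulo the
first one. -/
noncomputable def remainderZero (f : MvPolynomial (Fin 3) K) : MvPolynomial (Fin 3) K :=
  pderiv 2 f * pderiv 2 f * pderiv 2 f * secondDeriv f 0 -
    pderiv 2 f * pderiv 2 f * pderiv 0 f * secondDeriv f 2 +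
    pderiv 2 f * pderiv 0 f * pderiv 1 f * secondDeriv f 3 -
    pderiv 0 f * pderiv 1 f * pderiv 1 f * secondDeriv f 4 +
    pderiv 0 f * pderiv 0 f * pderiv 2 f * secondDeriv f 4

theorem totalDegree_remainder_le (f : MvPolynomial (Fin 3) K) :
    (remainderOne f).totalDegree ≤ 4 * f.totalDegree ∧
      (remainderZero f).totalDegree ≤ 4 * f.totalDegree := by
  have h1 : ∀ i j k m, (pderiv i f * pderiv j f * pderiv k f * secondDeriv f m).totalDegree ≤
      4 * f.totalDegree := by
    intro i j k m
    have hi := totalDegree_pderiv_le (f := f) i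
    have hj := totalDegree_pderiv_le (f := f) j
    have hk := totalDegree_pderiv_le (f := f) k
    have hm := totalDegree_secondDeriv_le f m
    have h3 := totalDegree_mul (pderiv i f * pderiv j f * pderiv k f) (secondDeriv f m)
    have h4 := totalDegree_mul (pderiv i f * pderiv j f) (pderiv k f)
    have h5 := totalDegree_mul (pderiv i f) (pderiv j f)
    omega
  have ha : ∀ {P Q : MvPolynomial (Fin 3) K}, P.totalDegree ≤ 4 * f.totalDegree →
      Q.totalDegree ≤ 4 * f.totalDegree → (P + Q).totalDegree ≤ 4 * f.totalDegree :=
    fun hP hQ => (totalDegree_add _ _).trans (max_le hP hQ)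
  have hs : ∀ {P Q : MvPolynomial (Fin 3) K}, P.totalDegree ≤ 4 * f.totalDegree →
      Q.totalDegree ≤ 4 * f.totalDegree → (P - Q).totalDegree ≤ 4 * f.totalDegree :=
    fun hP hQ => (totalDegree_sub _ _).trans (max_le hP hQ)
  exact ⟨hs (ha (ha (hs (ha (hs (h1 _ _ _ _) (h1 _ _ _ _)) (h1 _ _ _ _)) (h1 _ _ _ _))
    (h1 _ _ _ _)) (h1 _ _ _ _)) (h1 _ _ _ _),
    ha (hs (ha (hs (h1 _ _ _ _) (h1 _ _ _ _)) (h1 _ _ _ _)) (h1 _ _ _ _)) (h1 _ _ _ _)⟩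

theorem eval_derivative_of_restrictLine_eq_zero {f : MvPolynomial (Fin 3) K} {q : Fin 3 → K}
    {t : K} (h : restrictLine (lineThrough q t) f = 0) :
    eval q (pderiv 0 f) + t * eval q (pderiv 1 f) + t ^ 2 * eval q (pderiv 2 f) = 0 := by
  have h1 := derivative_restrictLine (lineThrough q t) f
  rw [h] at h1
  have h2 := congrArg (Polynomial.eval (q 0)) h1
  simp only [Polynomial.eval_add, Polynomial.eval_mul, Polynomial.eval_C, eval_restrictLine,
    nullPoint_lineThrough, Polynomial.derivative_zero, Polynomial.eval_zero] at h2
  exact h2.symm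

theorem eval_secondDeriv_of_restrictLine_eq_zero {f : MvPolynomial (Fin 3) K} {q : Fin 3 → K}
    {t : K} (h : restrictLine (lineThrough q t) f = 0) :
    eval q (secondDeriv f 0) + t * eval q (secondDeriv f 1) + t ^ 2 * eval q (secondDeriv f 2) +
      t ^ 3 * eval q (secondDeriv f 3) + t ^ 4 * eval q (secondDeriv f 4) = 0 := by
  have h1 := derivative_derivative_restrictLine (lineThrough q t) f
  rw [h] at h1
  have h2 := congrArg (Polynomial.eval (q 0)) h1
  simp only [Polynomial.eval_add, Polynomial.eval_mul, Polynomial.eval_C, eval_restrictLine,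
    nullPoint_lineThrough, Polynomial.derivative_zero, Polynomial.eval_zero,
    Polynomial.eval_pow] at h2
  exact h2.symm

/-- The remainders vanish at points lying on two null lines of the surface. -/
theorem eval_remainder_eq_zero {f : MvPolynomial (Fin 3) K} {q : Fin 3 → K}
    {t t' : K} (ht : t ≠ t') (h : restrictLine (lineThrough q t) f = 0)
    (h' : restrictLine (lineThrough q t') f = 0) :
    eval q (remainderOne f) = 0 ∧ eval q (remainderZero f) = 0 := by
  have key : ∀ s, restrictLine (lineThrough q s) f = 0 →
      eval q (remainderOne f) * s + eval q (remainderZero f) = 0 := by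
    intro s hs
    have h1 := eval_derivative_of_restrictLine_eq_zero hs
    have h2 := eval_secondDeriv_of_restrictLine_eq_zero hs
    simp only [remainderOne, remainderZero, map_add, map_sub, map_mul]
    generalize eval q (pderiv 0 f) = a at *
    generalize eval q (pderiv 1 f) = b at *
    generalize eval q (pderiv 2 f) = c at *
    generalize eval q (secondDeriv f 0) = A0 at *
    generalize eval q (secondDeriv f 1) = A1 at *
    generalize eval q (secondDeriv f 2) = A2 at *
    generalize eval q (secondDeriv f 3) = A3 at *
    generalize eval q (secondDeriv f 4) = A4 at *
    linear_combination c ^ 3 * h2 - h1 * (A2 * c ^ 2 + A3 * (c ^ 2 * s - b * c) +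
      A4 * (c ^ 2 * s ^ 2 - b * c * s + (b ^ 2 - a * c)))
  have h1 := key t h
  have h2 := key t' h'
  have h3 : eval q (remainderOne f) = 0 := by
    have : eval q (remainderOne f) * (t - t') = 0 := by linear_combination h1 - h2
    exact (mul_eq_zero.1 this).resolve_right (sub_ne_zero.2 ht)
  refine ⟨h3, ?_⟩
  rw [h3] at h1
  simpa using h1

/-- On a surface containing the zero sets of its remainders, null tangent directions at points where
the third partial derivative does not vanish extend to null lines. -/
theorem restrictLine_eq_zero_of_tangent {p : ℕ} [CharP K p] {f : MvPolynomial (Fin 3) K}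
    (hp : f.totalDegree < p) (h1 : f ∣ remainderOne f) (h0 : f ∣ remainderZero f)
    {q : Fin 3 → K} {t : K} (hq : eval q f = 0) (hc : eval q (pderiv 2 f) ≠ 0)
    (ht : eval q (pderiv 0 f) + t * eval q (pderiv 1 f) + t ^ 2 * eval q (pderiv 2 f) = 0) :
    restrictLine (lineThrough q t) f = 0 := by
  obtain ⟨g1, hg1⟩ := h1
  obtain ⟨g0, hg0⟩ := h0
  set l := lineThrough q t with hl
  have hl1 : l.1 = t := rfl
  have e1 := congrArg (restrictLine l) hg1
  have e0 := congrArg (restrictLine l) hg0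
  have d1 := derivative_restrictLine l f
  have d2 := derivative_derivative_restrictLine l f
  refine eq_zero_of_second_order_equation (p := p) (x := q 0) (γ := restrictLine l (pderiv 2 f) ^ 3)
    (A := restrictLine l (secondDeriv f 2) * restrictLine l (pderiv 2 f) ^ 2 +
      restrictLine l (secondDeriv f 3) * (restrictLine l (pderiv 2 f) ^ 2 * Polynomial.C t -
        restrictLine l (pderiv 1 f) * restrictLine l (pderiv 2 f)) +
      restrictLine l (secondDeriv f 4) * (restrictLine l (pderiv 2 f) ^ 2 * Polynomial.C t ^ 2 -
        restrictLine l (pderiv 1 f) * restrictLine l (pderiv 2 f) * Polynomial.C t +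
        (restrictLine l (pderiv 1 f) ^ 2 - restrictLine l (pderiv 0 f) *
          restrictLine l (pderiv 2 f))))
    (B := restrictLine l g1 * Polynomial.C t + restrictLine l g0)
    ((natDegree_restrictLine_le _ _).trans_lt hp) ?_ ?_ ?_ ?_
  · rw [d2, d1, hl1]
    simp only [remainderOne, remainderZero, map_add, map_sub, map_mul, map_pow] at e1 e0 ⊢
    linear_combination e1 * Polynomial.C t + e0
  · rw [Polynomial.eval_pow, eval_restrictLine, hl, nullPoint_lineThrough]
    exact pow_ne_zero _ hc
  · rw [eval_restrictLine, hl, nullPoint_lineThrough, hq]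
  · rw [d1, hl]
    simp only [Polynomial.eval_add, Polynomial.eval_mul, Polynomial.eval_C, eval_restrictLine,
      nullPoint_lineThrough]
    exact ht

end SecondOrder

section Spheres

variable {K : Type*} [Field K]

open MvPolynomial

/-- The condition that a null line lies on the quadric
`h₀ (x z - y²) + h₁ x + h₂ y + h₃ z + h₄ = 0`. -/
def MemSphere (h : Fin 5 → K) (l : K × K × K) : Prop :=
  h 0 * (l.2.2 - 2 * l.2.1 * l.1) + h 1 + h 2 * l.1 + h 3 * l.1 ^ 2 = 0 ∧
    -h 0 * l.2.1 ^ 2 + h 2 * l.2.1 + h 3 * l.2.2 + h 4 = 0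

/-- The polynomial `h₀ (x z - y²) + h₁ x + h₂ y + h₃ z + h₄`. -/
noncomputable def spherePoly (h : Fin 5 → K) : MvPolynomial (Fin 3) K :=
  C (h 0) * (X 0 * X 2 - X 1 ^ 2) + C (h 1) * X 0 + C (h 2) * X 1 + C (h 3) * X 2 + C (h 4)

theorem restrictLine_spherePoly (h : Fin 5 → K) (l : K × K × K) :
    restrictLine l (spherePoly h) =
      Polynomial.C (h 0 * (l.2.2 - 2 * l.2.1 * l.1) + h 1 + h 2 * l.1 + h 3 * l.1 ^ 2) *
        Polynomial.X +
      Polynomial.C (-h 0 * l.2.1 ^ 2 + h 2 * l.2.1 + h 3 * l.2.2 + h 4) := by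
  have h2 : (Polynomial.C (2 : K)) = 2 := rfl
  simp [spherePoly, restrictLine, h2]
  ring

theorem memSphere_iff (h : Fin 5 → K) (l : K × K × K) :
    MemSphere h l ↔ restrictLine l (spherePoly h) = 0 := by
  rw [restrictLine_spherePoly]
  constructor
  · rintro ⟨h1, h2⟩
    rw [h1, h2]
    simp
  · intro h0
    have e0 := congrArg (fun P : Polynomial K => P.coeff 0) h0
    have e1 := congrArg (fun P : Polynomial K => P.coeff 1) h0
    simp only [Polynomial.coeff_add, Polynomial.coeff_C_mul, Polynomial.coeff_X_zero, mul_zero,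
      zero_add, Polynomial.coeff_C_zero, Polynomial.coeff_zero, Polynomial.coeff_X_one, mul_one,
      Polynomial.coeff_C_succ, add_zero] at e0 e1
    exact ⟨e1, e0⟩

theorem memSphere_of_two_points {h : Fin 5 → K} {l : K × K × K} {x y : K} (hxy : x ≠ y)
    (hx : eval (nullPoint l x) (spherePoly h) = 0)
    (hy : eval (nullPoint l y) (spherePoly h) = 0) : MemSphere h l := by
  rw [← eval_restrictLine, restrictLine_spherePoly] at hx hy
  simp only [Polynomial.eval_add, Polynomial.eval_mul, Polynomial.eval_C,
    Polynomial.eval_X] at hx hy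
  have h1 := sub_ne_zero.2 hxy
  have h2 : h 0 * (l.2.2 - 2 * l.2.1 * l.1) + h 1 + h 2 * l.1 + h 3 * l.1 ^ 2 = 0 := by
    refine (mul_eq_zero.1 (?_ : _ * (x - y) = 0)).resolve_right h1
    linear_combination hx - hy
  refine ⟨h2, ?_⟩
  rw [h2] at hx
  simpa using hx

theorem exists_memSphere_pair (l l' : K × K × K) :
    ∃ h : Fin 5 → K, h ≠ 0 ∧ MemSphere h l ∧ MemSphere h l' := by
  let M : Matrix (Fin 4) (Fin 5) K := !![
    l.2.2 - 2 * l.2.1 * l.1, 1, l.1, l.1 ^ 2, 0;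
    - l.2.1 ^ 2, 0, l.2.1, l.2.2, 1;
    l'.2.2 - 2 * l'.2.1 * l'.1, 1, l'.1, l'.1 ^ 2, 0;
    - l'.2.1 ^ 2, 0, l'.2.1, l'.2.2, 1]
  obtain ⟨h, hh, h0⟩ := Submodule.exists_mem_ne_zero_of_ne_bot
    (LinearMap.ker_ne_bot_of_finrank_lt (f := M.mulVecLin) (by simp))
  refine ⟨h, h0, ?_⟩
  rw [LinearMap.mem_ker] at hh
  have e0 := congrFun hh 0
  have e1 := congrFun hh 1
  have e2 := congrFun hh 2
  have e3 := congrFun hh 3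
  simp [M, Matrix.mulVec, dotProduct, Fin.sum_univ_succ] at e0 e1 e2 e3
  refine ⟨⟨?_, ?_⟩, ?_, ?_⟩
  · linear_combination e0
  · linear_combination e1
  · linear_combination e2
  · linear_combination e3

theorem dvd_of_infinite {f g : MvPolynomial (Fin 3) K} (hf : Irreducible f)
    {s : Set (K × K × K)} (hs : s.Infinite) (hsf : ∀ l ∈ s, restrictLine l f = 0)
    (hsg : ∀ l ∈ s, restrictLine l g = 0) : f ∣ g := by
  by_contra hfg
  obtain ⟨t, hts, htc⟩ := hs.exists_subset_card_eq (f.totalDegree * g.totalDegree + 1)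
  have := card_le_totalDegree_mul hf hfg t (fun l hl => hsf l (hts hl))
    (fun l hl => hsg l (hts hl))
  omega

theorem eval_aeval_fin (w : Fin 3 → K) (g : Fin 3 → MvPolynomial (Fin 3) K)
    (f : MvPolynomial (Fin 3) K) :
    eval w (aeval g f) = eval (fun i => eval w (g i)) f := by
  induction f using MvPolynomial.induction_on with
  | C a => simp
  | add p q hp hq => rw [map_add, map_add, map_add, hp, hq]
  | mul_X p i hp => rw [map_mul, map_mul, map_mul, hp, aeval_X, eval_X]

theorem nullPoint_lineThrough_apply (q : Fin 3 → K) (t x : K) :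
    nullPoint (lineThrough q t) x =
      ![x, q 1 + t * (x - q 0), q 2 + t ^ 2 * (x - q 0)] := by
  ext i
  fin_cases i <;> simp [nullPoint, lineThrough] <;> ring

theorem infinite_eval_ne_zero [Infinite K] {P : Polynomial K} (hP : P ≠ 0) :
    {x | P.eval x ≠ 0}.Infinite := by
  have := (Polynomial.finite_setOfPred_isRoot hP).infinite_compl
  exact this

/-- If infinitely many null lines crossing `l` lie on an irreducible surface, then so do the null
lines joining points of the surface to `l`. -/
theorem restrictLine_joining_eq_zero [Infinite K] {f : MvPolynomial (Fin 3) K} (hf : Irreducible f)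
    (l : K × K × K) {s : Set K} (hs : s.Infinite) (τ : K → K) (hτ : ∀ x ∈ s, τ x ≠ l.1)
    (hsf : ∀ x ∈ s, restrictLine (lineThrough (nullPoint l x) (τ x)) f = 0)
    {w : Fin 3 → K} (hw : eval w f = 0) (hY : w 1 - l.2.1 - l.1 * w 0 ≠ 0) :
    restrictLine (lineThrough w
      ((w 2 - l.2.2 - l.1 ^ 2 * w 0) / (w 1 - l.2.1 - l.1 * w 0) - l.1)) f = 0 := by
  obtain ⟨t, u, v⟩ := l
  simp only at hτ hY ⊢
  let Y : MvPolynomial (Fin 3) K := X 1 - C u - C t * X 0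
  let Γ : MvPolynomial (Fin 3) K := X 2 - C v - C (t ^ 2) * X 0 - C t * Y
  let g : K → Fin 3 → MvPolynomial (Fin 3) K := fun c =>
    ![X 0 + C c * Y ^ 2, X 1 + C c * (Y * Γ), X 2 + C c * Γ ^ 2]
  have hinj : Set.InjOn (fun x => lineThrough (nullPoint (t, u, v) x) (τ x)) s := by
    intro x hx y hy hxy
    have e1 := congrArg Prod.fst hxy
    have e2 := congrArg (fun z : K × K × K => z.2.1) hxy
    simp only [lineThrough, nullPoint, Matrix.cons_val_one, Matrix.cons_val_zero] at e1 e2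
    have : (t - τ x) * (x - y) = 0 := by
      rw [← e1] at e2
      linear_combination e2
    exact sub_eq_zero.1 ((mul_eq_zero.1 this).resolve_left (sub_ne_zero.2 (hτ x hx).symm))
  have hdvd : ∀ c, f ∣ aeval (g c) f := by
    intro c
    refine dvd_of_infinite hf (hs.image hinj) ?_ ?_
    · rintro _ ⟨x, hx, rfl⟩
      exact hsf x hx
    · rintro _ ⟨x, hx, rfl⟩
      refine Polynomial.funext fun z => ?_
      rw [eval_restrictLine, eval_aeval_fin, Polynomial.eval_zero]
      have h0 := congrArg (Polynomial.eval (z + c * ((τ x - t) * (z - x)) ^ 2)) (hsf x hx)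
      rw [eval_restrictLine, Polynomial.eval_zero] at h0
      convert h0 using 3
      rw [nullPoint_lineThrough_apply, nullPoint_lineThrough_apply]
      funext i
      fin_cases i
      · simp only [g, Y, nullPoint, Fin.zero_eta, Matrix.cons_val, map_add, map_sub, map_mul,
          map_pow, eval_X, eval_C]
        ring
      · simp [g, Y, Γ, nullPoint]
        ring
      · simp [g, Y, Γ, nullPoint]
        ring
  refine Polynomial.funext fun z => ?_
  rw [eval_restrictLine, Polynomial.eval_zero]
  obtain ⟨b, hb⟩ := hdvd ((z - w 0) / (w 1 - u - t * w 0) ^ 2)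
  have h0 := congrArg (eval w) hb
  rw [eval_aeval_fin, map_mul, hw, zero_mul] at h0
  convert h0 using 3
  rw [nullPoint_lineThrough_apply]
  funext i
  obtain ⟨y, hy⟩ : ∃ y, y = w 1 - u - t * w 0 := ⟨_, rfl⟩
  rw [← hy] at hY
  fin_cases i
  · simp [g, Y]
    rw [← hy]
    field_simp
    ring
  · simp [g, Y, Γ]
    rw [← hy]
    field_simp
  · simp [g, Y, Γ]
    rw [← hy]
    field_simp

end Spheres

section Umbilic

variable {K : Type*} [Field K]

open MvPolynomial

/-- The slope of the second null tangent direction at a point of a null line. -/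
noncomputable def residualSlope (f : MvPolynomial (Fin 3) K) (l : K × K × K) (x : K) : K :=
  -eval (nullPoint l x) (pderiv 1 f) / eval (nullPoint l x) (pderiv 2 f) - l.1

/-- A polynomial whose nonvanishing makes `residualSlope` meaningful. -/
noncomputable def slopeDisc (f : MvPolynomial (Fin 3) K) (t : K) : MvPolynomial (Fin 3) K :=
  pderiv 2 f * (C (2 * t) * pderiv 2 f + pderiv 1 f)

theorem residualSlope_spec {p : ℕ} [CharP K p] {f : MvPolynomial (Fin 3) K}
    (hp : f.totalDegree < p) (h1 : f ∣ remainderOne f) (h0 : f ∣ remainderZero f)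
    {l : K × K × K} (hl : restrictLine l f = 0) {x : K}
    (hx : (restrictLine l (slopeDisc f l.1)).eval x ≠ 0) :
    residualSlope f l x ≠ l.1 ∧
      restrictLine (lineThrough (nullPoint l x) (residualSlope f l x)) f = 0 ∧
      eval (nullPoint l x) (slopeDisc f (residualSlope f l x)) ≠ 0 := by
  rw [eval_restrictLine] at hx
  simp only [slopeDisc, map_mul, map_add, eval_C] at hx ⊢
  have hc := left_ne_zero_of_mul hx
  have hs := right_ne_zero_of_mul hx
  have hτ : eval (nullPoint l x) (pderiv 2 f) * residualSlope f l x =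
      -eval (nullPoint l x) (pderiv 1 f) - eval (nullPoint l x) (pderiv 2 f) * l.1 := by
    rw [residualSlope]
    field_simp
  have hq : eval (nullPoint l x) f = 0 := by
    rw [← eval_restrictLine, hl, Polynomial.eval_zero]
  have hne : residualSlope f l x ≠ l.1 := by
    intro h
    rw [h] at hτ
    exact hs (by linear_combination hτ)
  refine ⟨hne, restrictLine_eq_zero_of_tangent hp h1 h0 hq hc ?_, ?_⟩
  · have h2 := eval_derivative_of_restrictLine_eq_zero
      ((lineThrough_nullPoint l x).symm ▸ hl : restrictLine (lineThrough (nullPoint l x) l.1) f = 0)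
    linear_combination h2 + (residualSlope f l x - l.1) * hτ
  · intro h
    have h3 := (mul_eq_zero.1 h).resolve_left hc
    have h4 : eval (nullPoint l x) (pderiv 2 f) * (residualSlope f l x - l.1) = 0 := by
      linear_combination h3 - hτ
    exact mul_ne_zero hc (sub_ne_zero.2 hne) h4

theorem exists_memSphere_of_slopeDisc [Infinite K] {p : ℕ} [CharP K p] {f : MvPolynomial (Fin 3) K}
    (hf : Irreducible f) (hp : f.totalDegree < p) (h1 : f ∣ remainderOne f)
    (h0 : f ∣ remainderZero f) {l : K × K × K} (hl : restrictLine l f = 0)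
    (hd : restrictLine l (slopeDisc f l.1) ≠ 0) :
    ∃ h : Fin 5 → K, h ≠ 0 ∧ ∀ l', restrictLine l' f = 0 → MemSphere h l' := by
  have hinf := infinite_eval_ne_zero hd
  have hres := fun x (hx : (restrictLine l (slopeDisc f l.1)).eval x ≠ 0) =>
    residualSlope_spec hp h1 h0 hl hx
  obtain ⟨x0, hx0⟩ := hinf.nonempty
  obtain ⟨ha1, ha2, ha3⟩ := hres x0 hx0
  set τ₁ := residualSlope f l x0 with hτ₁
  set m := lineThrough (nullPoint l x0) τ₁ with hm
  have hm1 : m.1 = τ₁ := rfl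
  have hmd : restrictLine m (slopeDisc f m.1) ≠ 0 := by
    intro h
    have := congrArg (Polynomial.eval x0) h
    rw [eval_restrictLine, Polynomial.eval_zero, hm1] at this
    apply ha3
    rw [← this]
    congr 2
    exact (nullPoint_lineThrough (nullPoint l x0) τ₁).symm
  obtain ⟨y, hy, hyx⟩ := (infinite_eval_ne_zero hmd).exists_notMem_finset {x0}
  rw [Finset.mem_singleton] at hyx
  obtain ⟨hb1, hb2, -⟩ := residualSlope_spec hp h1 h0 ha2 hy
  set τ₂ := residualSlope f m y with hτ₂
  rw [hm1] at hb1
  set n := lineThrough (nullPoint m y) τ₂ with hn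
  obtain ⟨h, hh0, hhl, hhn⟩ := exists_memSphere_pair l n
  refine ⟨h, hh0, fun l' hl' => ?_⟩
  obtain ⟨t, u, v⟩ := l
  simp only at ha1
  have hw : ∀ z, nullPoint n z = ![z, u + t * x0 + τ₁ * (y - x0) + τ₂ * (z - y),
      v + t ^ 2 * x0 + τ₁ ^ 2 * (y - x0) + τ₂ ^ 2 * (z - y)] := by
    intro z
    rw [hn, nullPoint_lineThrough_apply, hm, nullPoint_lineThrough_apply]
    simp [nullPoint]
  let Y : K → K := fun z => (τ₁ - t) * (y - x0) + (τ₂ - t) * (z - y)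
  let Z : K → K := fun z => (τ₁ ^ 2 - t ^ 2) * (y - x0) + (τ₂ ^ 2 - t ^ 2) * (z - y)
  have hY : ∀ z, nullPoint n z 1 - u - t * nullPoint n z 0 = Y z := by
    intro z
    rw [hw]
    simp [Y]
    ring
  have hZ : ∀ z, nullPoint n z 2 - v - t ^ 2 * nullPoint n z 0 = Z z := by
    intro z
    rw [hw]
    simp [Z]
    ring
  let Q : Polynomial K := (Polynomial.C ((τ₁ - t) * (y - x0)) +
      Polynomial.C (τ₂ - t) * (Polynomial.X - Polynomial.C y)) *
    (Polynomial.C ((τ₁ - t) ^ 2 * (y - x0)) +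
      Polynomial.C ((τ₂ - t) ^ 2) * (Polynomial.X - Polynomial.C y))
  have hQe : ∀ z, Q.eval z = Y z * (Z z - 2 * t * Y z) := by
    intro z
    simp only [Q, Y, Z, Polynomial.eval_mul, Polynomial.eval_add, Polynomial.eval_C,
      Polynomial.eval_sub, Polynomial.eval_X]
    ring
  have hyx' := sub_ne_zero.2 hyx
  have ha1' := sub_ne_zero.2 ha1
  have hQ : Q ≠ 0 := by
    intro h
    have := congrArg (Polynomial.eval y) h
    simp [Q, hyx', ha1'] at this
  have hQinf := infinite_eval_ne_zero hQ
  have hgood : ∀ z ∈ {z | Q.eval z ≠ 0}, Y z ≠ 0 ∧ Z z / Y z - t ≠ t := by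
    intro z hz
    rw [Set.mem_ofPred_eq, hQe] at hz
    refine ⟨left_ne_zero_of_mul hz, fun h => right_ne_zero_of_mul hz ?_⟩
    have := left_ne_zero_of_mul hz
    have h2 : Z z / Y z = 2 * t := by linear_combination h
    rw [div_eq_iff this] at h2
    linear_combination h2
  rw [memSphere_iff]
  have hdvd : f ∣ spherePoly h := by
    refine dvd_of_infinite hf (s := (fun z => lineThrough (nullPoint n z) (Z z / Y z - t)) ''
      {z | Q.eval z ≠ 0}) (hQinf.image ?_) ?_ ?_
    · intro z hz z' _ hzz
      have e1 : Z z / Y z - t = Z z' / Y z' - t := congrArg Prod.fst hzz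
      have e2 := congrArg (fun z : K × K × K => z.2.1) hzz
      simp only [lineThrough] at e2
      rw [← e1, hw, hw] at e2
      simp only [Matrix.cons_val_one, Matrix.cons_val_zero] at e2
      have e3 : (τ₂ - (Z z / Y z - t)) * (z - z') = 0 := by
        linear_combination e2
      refine sub_eq_zero.1 ((mul_eq_zero.1 e3).resolve_left fun e4 => ?_)
      have e5 : Z z / Y z = τ₂ + t := by linear_combination -e4
      rw [div_eq_iff (hgood z hz).1] at e5
      have e6 : (τ₁ - t) * (y - x0) * (τ₁ - τ₂) = 0 := by
        simp only [Y, Z] at e5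
        linear_combination e5
      exact mul_ne_zero (mul_ne_zero ha1' hyx') (sub_ne_zero.2 hb1.symm) e6
    · rintro _ ⟨z, hz, rfl⟩
      have := restrictLine_joining_eq_zero hf (t, u, v) hinf (residualSlope f (t, u, v))
        (fun x hx => (hres x hx).1) (fun x hx => (hres x hx).2.1) (w := nullPoint n z)
        (by rw [← eval_restrictLine, hb2, Polynomial.eval_zero])
        (by
          simp only [hY]
          exact (hgood z hz).1)
      simpa only [hY, hZ] using this
    · rintro _ ⟨z, hz, rfl⟩
      rw [← memSphere_iff]
      obtain ⟨hY0, hτ⟩ := hgood z hz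
      have hτ' := sub_ne_zero.2 hτ
      refine memSphere_of_two_points (x := z) (y := z - Y z / (Z z / Y z - t - t)) ?_ ?_ ?_
      · intro h
        have : Y z / (Z z / Y z - t - t) = 0 := by linear_combination h
        exact div_ne_zero hY0 hτ' this
      · have e : nullPoint n z 0 = z := by simp [nullPoint]
        have := nullPoint_lineThrough (nullPoint n z) (Z z / Y z - t)
        rw [e] at this
        rw [this, ← eval_restrictLine, (memSphere_iff _ _).1 hhn, Polynomial.eval_zero]
      · have hl0 := congrArg (Polynomial.eval (z - Y z / (Z z / Y z - t - t)))
          ((memSphere_iff _ _).1 hhl)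
        rw [eval_restrictLine, Polynomial.eval_zero] at hl0
        convert hl0 using 3
        rw [nullPoint_lineThrough_apply]
        have e0 : nullPoint n z 0 = z := by simp [nullPoint]
        have e1 : nullPoint n z 1 = Y z + u + t * z := by
          have := hY z
          rw [e0] at this
          linear_combination this
        have e2 : nullPoint n z 2 = Z z + v + t ^ 2 * z := by
          have := hZ z
          rw [e0] at this
          linear_combination this
        have hD : Y z / (Z z / Y z - t - t) * (Z z / Y z - t - t) = Y z := div_mul_cancel₀ _ hτ'
        have hE : Z z / Y z * Y z = Z z := div_mul_cancel₀ _ hY0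
        rw [e0, e1, e2]
        generalize Z z / Y z = r at *
        generalize Y z / (r - t - t) = s at *
        funext i
        fin_cases i
        · simp [nullPoint]
        · simp [nullPoint]
          linear_combination -hD
        · simp [nullPoint]
          linear_combination -hE - r * hD
  obtain ⟨g, hg⟩ := hdvd
  rw [hg, map_mul, hl', zero_mul]

/-- An irreducible surface with many null lines that cross many other null lines of the surface
is contained in a quadric all of whose null lines satisfy `MemSphere`. -/
theorem exists_memSphere_of_rich [Infinite K] {p : ℕ} [CharP K p] {f : MvPolynomial (Fin 3) K}
    (hf : Irreducible f) (hp : f.totalDegree < p) (R : Finset (K × K × K))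
    (hR : ∀ l ∈ R, restrictLine l f = 0)
    (hrich : ∀ l ∈ R, ∃ s : Finset K, 4 * f.totalDegree < s.card ∧
      ∀ x ∈ s, ∃ t, t ≠ l.1 ∧ restrictLine (lineThrough (nullPoint l x) t) f = 0)
    (hcard : 4 * f.totalDegree ^ 2 < R.card) :
    ∃ h : Fin 5 → K, h ≠ 0 ∧ ∀ l, restrictLine l f = 0 → MemSphere h l := by
  have hvan : ∀ l ∈ R, ∀ g : MvPolynomial (Fin 3) K, g.totalDegree ≤ 4 * f.totalDegree →
      (∀ x t, t ≠ l.1 → restrictLine (lineThrough (nullPoint l x) t) f = 0 →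
        eval (nullPoint l x) g = 0) → restrictLine l g = 0 := by
    intro l hl g hg h
    obtain ⟨s, hs, hs'⟩ := hrich l hl
    refine restrictLine_eq_zero_of_card_lt (s := s) ?_ (hg.trans_lt hs)
    intro x hx
    obtain ⟨t, ht, ht'⟩ := hs' x hx
    exact h x t ht ht'
  have hdvd : ∀ g : MvPolynomial (Fin 3) K, g.totalDegree ≤ 4 * f.totalDegree →
      (∀ l ∈ R, restrictLine l g = 0) → f ∣ g := by
    intro g hg h
    by_contra hfg
    have := card_le_totalDegree_mul hf hfg R hR h
    nlinarith
  have hself : ∀ l ∈ R, ∀ x, restrictLine (lineThrough (nullPoint l x) l.1) f = 0 := by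
    intro l hl x
    rw [lineThrough_nullPoint]
    exact hR l hl
  have h1 : f ∣ remainderOne f := hdvd _ (totalDegree_remainder_le f).1 fun l hl =>
    hvan l hl _ (totalDegree_remainder_le f).1 fun x t ht h =>
      (eval_remainder_eq_zero ht h (hself l hl x)).1
  have h0 : f ∣ remainderZero f := hdvd _ (totalDegree_remainder_le f).2 fun l hl =>
    hvan l hl _ (totalDegree_remainder_le f).2 fun x t ht h =>
      (eval_remainder_eq_zero ht h (hself l hl x)).2
  have hdeg : ∀ i, (pderiv i f).totalDegree ≤ 4 * f.totalDegree := fun i =>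
    (totalDegree_pderiv_le i).trans (by omega)
  have hf0 : f.totalDegree ≠ 0 := by
    intro h
    rw [totalDegree_eq_zero_iff_eq_C] at h
    have hc : coeff 0 f ≠ 0 := by
      intro hc
      rw [hc, map_zero] at h
      exact hf.ne_zero h
    refine hf.not_isUnit ?_
    rw [h]
    exact (isUnit_iff_ne_zero.2 hc).map C
  have hc : ¬ f ∣ pderiv 2 f := by
    intro hc
    have hc0 := pderiv_eq_zero_of_dvd hf0 hc
    have hab : ∀ l ∈ R, ∀ x t, t ≠ l.1 →
        restrictLine (lineThrough (nullPoint l x) t) f = 0 →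
        eval (nullPoint l x) (pderiv 1 f) = 0 ∧ eval (nullPoint l x) (pderiv 0 f) = 0 := by
      intro l hl x t ht h
      have e1 := eval_derivative_of_restrictLine_eq_zero h
      have e2 := eval_derivative_of_restrictLine_eq_zero (hself l hl x)
      rw [hc0, map_zero] at e1 e2
      have e3 : (t - l.1) * eval (nullPoint l x) (pderiv 1 f) = 0 := by
        linear_combination e1 - e2
      have e4 := (mul_eq_zero.1 e3).resolve_left (sub_ne_zero.2 ht)
      refine ⟨e4, ?_⟩
      rw [e4] at e1
      linear_combination e1
    have hb0 := pderiv_eq_zero_of_dvd hf0 (hdvd _ (hdeg 1) fun l hl =>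
      hvan l hl _ (hdeg 1) fun x t ht h => (hab l hl x t ht h).1)
    have ha0 := pderiv_eq_zero_of_dvd hf0 (hdvd _ (hdeg 0) fun l hl =>
      hvan l hl _ (hdeg 0) fun x t ht h => (hab l hl x t ht h).2)
    refine hf0 (totalDegree_eq_zero_of_pderiv_eq_zero hp fun i => ?_)
    fin_cases i
    · exact ha0
    · exact hb0
    · exact hc0
  obtain ⟨l, hl, hlc⟩ : ∃ l ∈ R, restrictLine l (pderiv 2 f) ≠ 0 := by
    by_contra! h
    exact hc (hdvd _ (hdeg 2) h)
  refine exists_memSphere_of_slopeDisc hf hp h1 h0 (hR l hl) ?_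
  rw [slopeDisc, map_mul]
  refine mul_ne_zero hlc fun hs => hlc (hvan l hl _ (hdeg 2) fun x t ht h => ?_)
  have e1 := eval_derivative_of_restrictLine_eq_zero h
  have e2 := eval_derivative_of_restrictLine_eq_zero (hself l hl x)
  have e3 := congrArg (Polynomial.eval x) hs
  rw [eval_restrictLine, Polynomial.eval_zero, map_add, map_mul, eval_C] at e3
  have e4 : (t - l.1) ^ 2 * eval (nullPoint l x) (pderiv 2 f) = 0 := by
    linear_combination e1 - e2 - (t - l.1) * e3
  exact (mul_eq_zero.1 e4).resolve_left (pow_ne_zero _ (sub_ne_zero.2 ht))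

end Umbilic

section Crossings

variable {K : Type*} [Field K]

/-- Two null lines of different slopes meet in a point. -/
def Cross (l l' : K × K × K) : Prop :=
  l.1 ≠ l'.1 ∧ l.2.2 - l'.2.2 = (l.1 + l'.1) * (l.2.1 - l'.2.1)

theorem Cross.symm {l l' : K × K × K} (h : Cross l l') : Cross l' l :=
  ⟨h.1.symm, by linear_combination -h.2⟩

/-- The first coordinate of the common point of two crossing null lines. -/
noncomputable def crossPoint (l l' : K × K × K) : K := (l'.2.1 - l.2.1) / (l.1 - l'.1)

theorem Cross.lineThrough_eq {l l' : K × K × K} (h : Cross l l') :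
    lineThrough (nullPoint l (crossPoint l l')) l'.1 = l' := by
  have h1 : crossPoint l l' * (l.1 - l'.1) = l'.2.1 - l.2.1 :=
    div_mul_cancel₀ _ (sub_ne_zero.2 h.1)
  refine Prod.ext rfl (Prod.ext ?_ ?_)
  · simp [lineThrough, nullPoint]
    linear_combination h1
  · simp [lineThrough, nullPoint]
    linear_combination (l.1 + l'.1) * h1 + h.2

theorem cross_lineThrough (q : Fin 3 → K) {t t' : K} (h : t ≠ t') :
    Cross (lineThrough q t) (lineThrough q t') :=
  ⟨h, by simp [lineThrough]; ring⟩

/-- No two null lines of the family cross. -/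
def NonCrossing (L : Finset (K × K × K)) : Prop := ∀ l ∈ L, ∀ l' ∈ L, ¬ Cross l l'

theorem NonCrossing.mono {L L' : Finset (K × K × K)} (h : NonCrossing L) (hL : L' ⊆ L) :
    NonCrossing L' := fun l hl l' hl' => h l (hL hl) l' (hL hl')

open Classical in
/-- The null lines of the family `L` that cross `l`. -/
noncomputable def crossers (l : K × K × K) (L : Finset (K × K × K)) : Finset (K × K × K) :=
  L.filter (Cross l)

/-- The number of crossings between two families of null lines. -/
noncomputable def crossings (L L' : Finset (K × K × K)) : ℕ := ∑ l ∈ L, (crossers l L').card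

theorem mem_crossers {l l' : K × K × K} {L : Finset (K × K × K)} :
    l' ∈ crossers l L ↔ l' ∈ L ∧ Cross l l' := by
  classical
  simp [crossers]

theorem crossers_card_le (l : K × K × K) (L : Finset (K × K × K)) :
    (crossers l L).card ≤ L.card := by
  classical
  exact Finset.card_filter_le _ _

theorem crossers_mono (l : K × K × K) {L L' : Finset (K × K × K)} (h : L ⊆ L') :
    (crossers l L).card ≤ (crossers l L').card := by
  classical
  exact Finset.card_le_card (Finset.filter_subset_filter _ h)

theorem crossers_card_union [DecidableEq K] (l : K × K × K) {L L' : Finset (K × K × K)}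
    (h : L ⊆ L') : (crossers l L').card = (crossers l L).card + (crossers l (L' \ L)).card := by
  classical
  conv_lhs => rw [← Finset.union_sdiff_of_subset h]
  rw [crossers, Finset.filter_union, Finset.card_union_of_disjoint]
  · rfl
  · exact Finset.disjoint_filter_filter Finset.disjoint_sdiff

theorem crossings_comm (L L' : Finset (K × K × K)) : crossings L L' = crossings L' L := by
  classical
  simp only [crossings, crossers, Finset.card_filter]
  rw [Finset.sum_comm]
  refine Finset.sum_congr rfl fun l _ => Finset.sum_congr rfl fun l' _ => ?_
  congr 1
  exact propext ⟨Cross.symm, Cross.symm⟩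

theorem crossings_mono_right (L : Finset (K × K × K)) {B B' : Finset (K × K × K)} (h : B ⊆ B') :
    crossings L B ≤ crossings L B' :=
  Finset.sum_le_sum fun l _ => crossers_mono l h

theorem crossings_split [DecidableEq K] (L : Finset (K × K × K)) {B B' : Finset (K × K × K)}
    (h : B ⊆ B') : crossings L B' = crossings L B + crossings L (B' \ B) := by
  rw [crossings, crossings, crossings, ← Finset.sum_add_distrib]
  exact Finset.sum_congr rfl fun l _ => crossers_card_union l h

theorem crossings_split_left [DecidableEq K] (L : Finset (K × K × K))
    {B B' : Finset (K × K × K)} (h : B ⊆ B') :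
    crossings B' L = crossings B L + crossings (B' \ B) L := by
  rw [crossings_comm, crossings_split L h, crossings_comm L, crossings_comm L]

theorem crossings_le_mul {L L' : Finset (K × K × K)} {d : ℕ}
    (h : ∀ l ∈ L, (crossers l L').card ≤ d) : crossings L L' ≤ d * L.card := by
  refine (Finset.sum_le_card_nsmul _ _ d h).trans ?_
  rw [smul_eq_mul, mul_comm]

theorem crossPoint_injOn {l : K × K × K} {L : Finset (K × K × K)} (hL : NonCrossing L) :
    Set.InjOn (crossPoint l) (crossers l L) := by
  intro a ha b hb hab
  rw [Finset.mem_coe, mem_crossers] at ha hb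
  have ea := ha.2.lineThrough_eq
  have eb := hb.2.lineThrough_eq
  by_cases hs : a.1 = b.1
  · rw [← ea, ← eb, hab, hs]
  · exfalso
    refine hL a ha.1 b hb.1 ?_
    rw [← ea, ← eb, hab]
    exact cross_lineThrough _ hs

/-- A null line outside a surface crosses few null lines of the surface. -/
theorem crossers_card_le_totalDegree {f : MvPolynomial (Fin 3) K} {l : K × K × K}
    (hl : restrictLine l f ≠ 0) {L : Finset (K × K × K)} (hL : NonCrossing L)
    (hf : ∀ l' ∈ L, restrictLine l' f = 0) : (crossers l L).card ≤ f.totalDegree := by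
  classical
  by_contra! h
  refine hl (restrictLine_eq_zero_of_card_lt (s := (crossers l L).image (crossPoint l)) ?_ ?_)
  · intro x hx
    obtain ⟨l', hl', rfl⟩ := Finset.mem_image.1 hx
    rw [mem_crossers] at hl'
    have h0 := hf l' hl'.1
    rw [← hl'.2.lineThrough_eq] at h0
    have h1 := congrArg (Polynomial.eval ((nullPoint l (crossPoint l l')) 0)) h0
    rwa [eval_restrictLine, nullPoint_lineThrough, Polynomial.eval_zero] at h1
  · rwa [Finset.card_image_of_injOn (crossPoint_injOn hL)]

theorem exists_irreducible_factors {f : MvPolynomial (Fin 3) K} (hf : f ≠ 0) :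
    ∃ Φ : Finset (MvPolynomial (Fin 3) K), (∀ g ∈ Φ, Irreducible g) ∧
      ∑ g ∈ Φ, g.totalDegree ≤ f.totalDegree ∧
      ∀ l, restrictLine l f = 0 → ∃ g ∈ Φ, restrictLine l g = 0 := by
  classical
  induction f using WfDvdMonoid.induction_on_irreducible with
  | zero => exact absurd rfl hf
  | unit u hu =>
    refine ⟨∅, by simp, by simp, fun l hl => ?_⟩
    exact absurd hl (hu.map (restrictLine l)).ne_zero
  | mul a i ha hi ih =>
    obtain ⟨Φ, h1, h2, h3⟩ := ih ha
    refine ⟨insert i Φ, ?_, ?_, ?_⟩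
    · intro g hg
      rcases Finset.mem_insert.1 hg with rfl | hg
      · exact hi
      · exact h1 g hg
    · rw [MvPolynomial.totalDegree_mul_of_isDomain hi.ne_zero ha]
      by_cases hm : i ∈ Φ
      · rw [Finset.insert_eq_of_mem hm]
        omega
      · rw [Finset.sum_insert hm]
        omega
    · intro l hl
      rw [map_mul] at hl
      rcases mul_eq_zero.1 hl with h | h
      · exact ⟨i, Finset.mem_insert_self _ _, h⟩
      · obtain ⟨g, hg, hg0⟩ := h3 l h
        exact ⟨g, Finset.mem_insert_of_mem hg, hg0⟩

/-- Crossings between null lines of an irreducible surface reduce to those between few lines. -/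
theorem exists_subset_crossings_le [Infinite K] {p : ℕ} [CharP K p] {f : MvPolynomial (Fin 3) K}
    (hf : Irreducible f) (hp : f.totalDegree < p) {A B : Finset (K × K × K)}
    (hA : NonCrossing A) (hB : NonCrossing B) (hAf : ∀ l ∈ A, restrictLine l f = 0)
    (hBf : ∀ l ∈ B, restrictLine l f = 0) {k : ℕ}
    (hk : ∀ h : Fin 5 → K, h ≠ 0 → (∀ l ∈ B, MemSphere h l) → B.card ≤ k) :
    ∃ R₁ ⊆ A, ∃ R₂ ⊆ B, R₁.card ≤ 4 * f.totalDegree ^ 2 ∧ R₂.card ≤ 4 * f.totalDegree ^ 2 ∧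
      crossings A B ≤ k * A.card + 4 * f.totalDegree * (A.card + B.card) + crossings R₁ R₂ := by
  classical
  have hrich : ∀ {A B : Finset (K × K × K)}, NonCrossing B → (∀ l ∈ A, restrictLine l f = 0) →
      (∀ l ∈ B, restrictLine l f = 0) →
      4 * f.totalDegree ^ 2 < (A.filter fun l => 4 * f.totalDegree < (crossers l B).card).card →
      ∃ h : Fin 5 → K, h ≠ 0 ∧ ∀ l, restrictLine l f = 0 → MemSphere h l := by
    intro A B hB hAf hBf hlt
    refine exists_memSphere_of_rich hf hp _ (fun l hl => hAf l (Finset.mem_filter.1 hl).1) ?_ hlt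
    intro l hl
    refine ⟨(crossers l B).image (crossPoint l), ?_, ?_⟩
    · rw [Finset.card_image_of_injOn (crossPoint_injOn hB)]
      exact (Finset.mem_filter.1 hl).2
    · intro x hx
      obtain ⟨l', hl', rfl⟩ := Finset.mem_image.1 hx
      rw [mem_crossers] at hl'
      exact ⟨l'.1, hl'.2.1.symm, hl'.2.lineThrough_eq.symm ▸ hBf l' hl'.1⟩
  by_cases hs : ∃ h : Fin 5 → K, h ≠ 0 ∧ ∀ l, restrictLine l f = 0 → MemSphere h l
  · obtain ⟨h, h0, hh⟩ := hs
    refine ⟨∅, by simp, ∅, by simp, by simp, by simp, ?_⟩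
    have := hk h h0 fun l hl => hh l (hBf l hl)
    have := crossings_le_mul (L := A) (L' := B) (d := k) fun l _ =>
      (crossers_card_le l B).trans this
    omega
  · refine ⟨A.filter fun l => 4 * f.totalDegree < (crossers l B).card, Finset.filter_subset _ _,
      B.filter fun l => 4 * f.totalDegree < (crossers l A).card, Finset.filter_subset _ _,
      not_lt.1 fun h => hs (hrich hB hAf hBf h), not_lt.1 fun h => hs (hrich hA hBf hAf h), ?_⟩
    set R₁ := A.filter fun l => 4 * f.totalDegree < (crossers l B).card with hR₁
    set R₂ := B.filter fun l => 4 * f.totalDegree < (crossers l A).card with hR₂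
    have h1 : crossings (A \ R₁) B ≤ 4 * f.totalDegree * A.card := by
      refine (crossings_le_mul (d := 4 * f.totalDegree) fun l hl => ?_).trans
        (Nat.mul_le_mul_left _ (Finset.card_le_card Finset.sdiff_subset))
      rw [Finset.mem_sdiff, hR₁, Finset.mem_filter] at hl
      exact not_lt.1 fun h => hl.2 ⟨hl.1, h⟩
    have h2 : crossings R₁ (B \ R₂) ≤ 4 * f.totalDegree * B.card := by
      rw [crossings_comm]
      refine (crossings_mono_right _ (Finset.filter_subset _ A)).trans ?_
      refine (crossings_le_mul (d := 4 * f.totalDegree) fun l hl => ?_).trans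
        (Nat.mul_le_mul_left _ (Finset.card_le_card Finset.sdiff_subset))
      rw [Finset.mem_sdiff, hR₂, Finset.mem_filter] at hl
      exact not_lt.1 fun h => hl.2 ⟨hl.1, h⟩
    have h3 : crossings A B = crossings R₁ B + crossings (A \ R₁) B :=
      crossings_split_left B (Finset.filter_subset _ A)
    have h4 : crossings R₁ B = crossings R₁ R₂ + crossings R₁ (B \ R₂) :=
      crossings_split R₁ (Finset.filter_subset _ B)
    rw [h3, h4, mul_add]
    linarith [Nat.zero_le (k * A.card)]

/-- Crossings between two families reduce to those between few lines, through polynomial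
partitioning by a surface of low degree containing the second family. -/
theorem exists_subset_crossings_le_sqrt [Infinite K] {p : ℕ} [CharP K p]
    {L₁ L₂ : Finset (K × K × K)} (h₁ : NonCrossing L₁) (h₂ : NonCrossing L₂) {d k : ℕ}
    (hd : 6 * L₂.card < (d + 1) ^ 2) (hp : d < p)
    (hk : ∀ h : Fin 5 → K, h ≠ 0 → ∀ B ⊆ L₂, (∀ l ∈ B, MemSphere h l) → B.card ≤ k) :
    ∃ R₁ ⊆ L₁, ∃ R₂ ⊆ L₂, R₁.card ≤ 4 * d ^ 2 ∧ R₂.card ≤ 4 * d ^ 2 ∧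
      crossings L₁ L₂ ≤ 5 * d * (L₁.card + L₂.card) + k * L₁.card + crossings R₁ R₂ := by
  classical
  obtain ⟨f, hf0, hfd, hfL⟩ := exists_restrictLine_eq_zero L₂ hd
  obtain ⟨Φ, hΦ, hΦd, hΦl⟩ := exists_irreducible_factors hf0
  choose! j hj hj0 using hΦl
  set D := L₁.filter fun l => restrictLine l f = 0 with hD
  let A : MvPolynomial (Fin 3) K → Finset (K × K × K) := fun g => D.filter fun l => j l = g
  let B : MvPolynomial (Fin 3) K → Finset (K × K × K) := fun g =>
    L₂.filter fun l => restrictLine l g = 0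
  have hDL : D ⊆ L₁ := Finset.filter_subset _ _
  have hAD : ∀ g, A g ⊆ D := fun g => Finset.filter_subset _ _
  have hBL : ∀ g, B g ⊆ L₂ := fun g => Finset.filter_subset _ _
  have hgd : ∀ g ∈ Φ, g.totalDegree ≤ d := fun g hg =>
    (Finset.single_le_sum (f := fun g => g.totalDegree) (fun _ _ => Nat.zero_le _) hg).trans
      (hΦd.trans hfd)
  have hAg : ∀ g, ∀ l ∈ A g, restrictLine l g = 0 := by
    intro g l hl
    rw [Finset.mem_filter, hD, Finset.mem_filter] at hl
    rw [← hl.2]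
    exact hj0 l hl.1.2
  have hex : ∀ g ∈ Φ, ∃ R₁ ⊆ A g, ∃ R₂ ⊆ B g, R₁.card ≤ 4 * g.totalDegree ^ 2 ∧
      R₂.card ≤ 4 * g.totalDegree ^ 2 ∧ crossings (A g) (B g) ≤
        k * (A g).card + 4 * g.totalDegree * ((A g).card + (B g).card) + crossings R₁ R₂ := by
    intro g hg
    refine exists_subset_crossings_le (hΦ g hg) ((hgd g hg).trans_lt hp)
      (h₁.mono ((hAD g).trans hDL)) (h₂.mono (hBL g)) (hAg g)
      (fun l hl => (Finset.mem_filter.1 hl).2) fun h h0 hh => hk h h0 _ (hBL g) hh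
  choose! R₁ hR₁ R₂ hR₂ hc₁ hc₂ hI using hex
  have hcard : ∀ R : MvPolynomial (Fin 3) K → Finset (K × K × K),
      (∀ g ∈ Φ, (R g).card ≤ 4 * g.totalDegree ^ 2) → (Φ.biUnion R).card ≤ 4 * d ^ 2 := by
    intro R hR
    calc (Φ.biUnion R).card ≤ ∑ g ∈ Φ, (R g).card := Finset.card_biUnion_le
      _ ≤ ∑ g ∈ Φ, 4 * d * g.totalDegree := Finset.sum_le_sum fun g hg => (hR g hg).trans (by
          have := hgd g hg
          nlinarith)
      _ = 4 * d * ∑ g ∈ Φ, g.totalDegree := by rw [Finset.mul_sum]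
      _ ≤ 4 * d * d := Nat.mul_le_mul_left _ (hΦd.trans hfd)
      _ = 4 * d ^ 2 := by ring
  have hsumA : ∑ g ∈ Φ, (A g).card = D.card := by
    rw [Finset.card_eq_sum_card_fiberwise (f := j) (t := Φ)]
    intro l hl
    exact hj l (Finset.mem_filter.1 hl).2
  have hDsum : crossings D L₂ = ∑ g ∈ Φ, crossings (A g) L₂ := by
    rw [crossings, ← Finset.sum_fiberwise_of_maps_to (t := Φ) (g := j)]
    · rfl
    · intro l hl
      exact hj l (Finset.mem_filter.1 hl).2
  have hout : crossings (L₁ \ D) L₂ ≤ d * L₁.card := by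
    refine (crossings_le_mul (d := d) fun l hl => ?_).trans
      (Nat.mul_le_mul_left _ (Finset.card_le_card Finset.sdiff_subset))
    rw [Finset.mem_sdiff, hD, Finset.mem_filter] at hl
    exact (crossers_card_le_totalDegree (fun h => hl.2 ⟨hl.1, h⟩) h₂ hfL).trans hfd
  have hAout : ∀ g ∈ Φ, crossings (A g) (L₂ \ B g) ≤ g.totalDegree * L₂.card := by
    intro g _
    rw [crossings_comm]
    refine (crossings_le_mul (d := g.totalDegree) fun l hl => ?_).trans
      (Nat.mul_le_mul_left _ (Finset.card_le_card Finset.sdiff_subset))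
    rw [Finset.mem_sdiff, Finset.mem_filter] at hl
    exact crossers_card_le_totalDegree (fun h => hl.2 ⟨hl.1, h⟩)
      (h₁.mono ((hAD g).trans hDL)) (hAg g)
  have hRsum : ∑ g ∈ Φ, crossings (R₁ g) (R₂ g) ≤
      crossings (Φ.biUnion R₁) (Φ.biUnion R₂) := by
    rw [crossings, Finset.sum_biUnion]
    · exact Finset.sum_le_sum fun g hg =>
        crossings_mono_right _ (Finset.subset_biUnion_of_mem R₂ hg)
    · intro g hg g' hg' hne
      rw [Function.onFun, Finset.disjoint_left]
      intro l hl hl'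
      exact hne ((Finset.mem_filter.1 (hR₁ g hg hl)).2.symm.trans
        (Finset.mem_filter.1 (hR₁ g' hg' hl')).2)
  refine ⟨Φ.biUnion R₁, Finset.biUnion_subset.2 fun g hg => (hR₁ g hg).trans ((hAD g).trans hDL),
    Φ.biUnion R₂, Finset.biUnion_subset.2 fun g hg => (hR₂ g hg).trans (hBL g),
    hcard R₁ hc₁, hcard R₂ hc₂, ?_⟩
  have hmain : ∀ g ∈ Φ, crossings (A g) L₂ ≤ (k + 4 * d) * (A g).card +
      5 * L₂.card * g.totalDegree + crossings (R₁ g) (R₂ g) := by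
    intro g hg
    rw [crossings_split (A g) (hBL g)]
    have e1 := hI g hg
    have e2 := hAout g hg
    have e3 : g.totalDegree * (A g).card ≤ d * (A g).card := Nat.mul_le_mul_right _ (hgd g hg)
    have e4 : g.totalDegree * (B g).card ≤ g.totalDegree * L₂.card :=
      Nat.mul_le_mul_left _ (Finset.card_le_card (hBL g))
    nlinarith
  have htot := Finset.sum_le_sum hmain
  rw [← hDsum, Finset.sum_add_distrib, Finset.sum_add_distrib, ← Finset.mul_sum,
    ← Finset.mul_sum, hsumA] at htot
  rw [crossings_split_left L₂ hDL]
  have hDc : D.card ≤ L₁.card := Finset.card_le_card hDL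
  have e5 : (k + 4 * d) * D.card ≤ (k + 4 * d) * L₁.card := Nat.mul_le_mul_left _ hDc
  have e6 : 5 * L₂.card * ∑ g ∈ Φ, g.totalDegree ≤ 5 * L₂.card * d :=
    Nat.mul_le_mul_left _ (hΦd.trans hfd)
  nlinarith

end Crossings

section Incidence

variable {K : Type*} [Field K]

theorem crossings_le_of_small_subsets {L L' : Finset (K × K × K)} {M X : ℕ} (hM : 0 < M)
    (h : ∀ B ⊆ L', B.card ≤ M → crossings L B ≤ X) :
    crossings L L' ≤ (L'.card / M + 1) * X := by
  classical
  induction hn : L'.card using Nat.strong_induction_on generalizing L' with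
  | _ n ih =>
    subst hn
    by_cases hle : L'.card ≤ M
    · exact (h L' subset_rfl hle).trans (Nat.le_mul_of_pos_left _ (Nat.succ_pos _))
    · push Not at hle
      obtain ⟨B, hB, hBM⟩ := Finset.exists_subset_card_eq hle.le
      have hc : (L' \ B).card = L'.card - M := by rw [Finset.card_sdiff_of_subset hB, hBM]
      have e1 := h B hB hBM.le
      have e2 := ih (L' \ B).card (by omega) (fun B' hB' =>
        h B' (hB'.trans Finset.sdiff_subset)) rfl
      rw [hc] at e2
      have e3 : L'.card / M = (L'.card - M) / M + 1 := Nat.div_eq_sub_div hM hle.le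
      rw [crossings_split L hB, e3]
      linarith [add_one_mul ((L'.card - M) / M + 1) X]

theorem crossings_le_card_mul_card (L L' : Finset (K × K × K)) :
    crossings L L' ≤ L'.card * L.card :=
  crossings_le_mul fun l _ => crossers_card_le l L'

/-- An incidence bound for null lines: two families of at most `m ^ 16` pairwise non-crossing null
lines, the second with at most `k` lines on each sphere, have `O(m ^ 24 + k m ^ 17)` crossings. -/
theorem crossings_le_pow [Infinite K] {p : ℕ} [CharP K p] {k : ℕ} (j : ℕ) :
    ∀ {m : ℝ}, 1 ≤ m → m ≤ 98 ^ j → m ^ 16 ≤ (p : ℝ) ^ 2 →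
    ∀ {L₁ L₂ : Finset (K × K × K)}, NonCrossing L₁ → NonCrossing L₂ →
    (L₁.card : ℝ) ≤ m ^ 16 → (L₂.card : ℝ) ≤ m ^ 16 →
    (∀ h : Fin 5 → K, h ≠ 0 → ∀ B ⊆ L₂, (∀ l ∈ B, MemSphere h l) → B.card ≤ k) →
    (crossings L₁ L₂ : ℝ) ≤ 98 ^ 16 * (m ^ 24 + k * m ^ 17) := by
  have base : ∀ {m : ℝ}, 1 ≤ m → m ≤ 2 * 98 → ∀ {L₁ L₂ : Finset (K × K × K)},
      (L₁.card : ℝ) ≤ m ^ 16 → (L₂.card : ℝ) ≤ m ^ 16 →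
      (crossings L₁ L₂ : ℝ) ≤ 98 ^ 16 * (m ^ 24 + k * m ^ 17) := by
    intro m h1 hm L₁ L₂ hL₁ hL₂
    have h0 : (0 : ℝ) ≤ m := by linarith
    have e1 : (crossings L₁ L₂ : ℝ) ≤ L₂.card * L₁.card := by
      exact_mod_cast crossings_le_card_mul_card L₁ L₂
    have e2 : (L₂.card : ℝ) * L₁.card ≤ m ^ 16 * m ^ 16 := by gcongr
    have e3 : m ^ 8 ≤ (2 * 98) ^ 8 := by gcongr
    have e4 : (2 * 98 : ℝ) ^ 8 ≤ 98 ^ 16 := by norm_num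
    have e5 : m ^ 16 * m ^ 16 = m ^ 8 * m ^ 24 := by ring
    have e6 : m ^ 8 * m ^ 24 ≤ 98 ^ 16 * m ^ 24 := by gcongr; exact e3.trans e4
    have e7 : 0 ≤ (k : ℝ) * m ^ 17 := by positivity
    linarith
  induction j with
  | zero =>
    intro m h1 hm _ L₁ L₂ _ _ hL₁ hL₂ _
    exact base h1 (by linarith) hL₁ hL₂
  | succ j ih =>
    intro m h1 hm hmp L₁ L₂ hn₁ hn₂ hL₁ hL₂ hk
    by_cases hmq : m ≤ 2 * 98
    · exact base h1 hmq hL₁ hL₂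
    push Not at hmq
    set t : ℝ := m / 98 with ht
    have hmt : m = 98 * t := by rw [ht]; ring
    have ht2 : 2 < t := by linarith
    have ht16 : (2 : ℝ) ^ 16 ≤ t ^ 16 := by gcongr
    set M : ℕ := ⌊t ^ 16 / 24⌋₊ with hMdef
    have hM1 : (M : ℝ) ≤ t ^ 16 / 24 := Nat.floor_le (by positivity)
    have hM2 : t ^ 16 / 48 ≤ M := by
      have := Nat.lt_floor_add_one (t ^ 16 / 24)
      rw [← hMdef] at this
      linarith
    have hM0 : 0 < M := by
      have : (0 : ℝ) < M := by linarith
      exact_mod_cast this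
    set d : ℕ := Nat.sqrt (6 * M) with hd
    have hd2 : d ^ 2 ≤ 6 * M := Nat.sqrt_le' _
    have hd3 : 6 * M < (d + 1) ^ 2 := Nat.lt_succ_sqrt' _
    clear_value d M
    have hd2' : (d : ℝ) ^ 2 ≤ t ^ 16 / 4 := by
      have : (d : ℝ) ^ 2 ≤ 6 * M := by exact_mod_cast hd2
      linarith
    have hd1 : (d : ℝ) ≤ t ^ 8 / 2 := by
      refine le_of_sq_le_sq ?_ (by positivity)
      calc (d : ℝ) ^ 2 ≤ t ^ 16 / 4 := hd2'
        _ = (t ^ 8 / 2) ^ 2 := by ring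
    have hdp : d < p := by
      have h3 : t ^ 16 ≤ m ^ 16 := by gcongr; linarith
      have : (d : ℝ) < p := lt_of_pow_lt_pow_left₀ 2 (by positivity) (by linarith)
      exact_mod_cast this
    have hsmall : ∀ B ⊆ L₂, B.card ≤ M → (crossings L₁ B : ℝ) ≤
        5 * m ^ 16 * t ^ 8 + k * m ^ 16 + 98 ^ 16 * (t ^ 24 + k * t ^ 17) := by
      intro B hB hBM
      have hlt : 6 * B.card < (d + 1) ^ 2 :=
        lt_of_le_of_lt (Nat.mul_le_mul_left _ hBM) hd3
      obtain ⟨R₁, hR₁, R₂, hR₂, hc₁, hc₂, hI⟩ := exists_subset_crossings_le_sqrt hn₁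
        (hn₂.mono hB) hlt hdp fun h h0 B' hB' => hk h h0 B' (hB'.trans hB)
      have hRc : ∀ R : Finset (K × K × K), R.card ≤ 4 * d ^ 2 → (R.card : ℝ) ≤ t ^ 16 := by
        intro R hR
        have : (R.card : ℝ) ≤ 4 * d ^ 2 := by exact_mod_cast hR
        linarith
      have hrec := ih (m := t) (by linarith) (by rw [pow_succ] at hm; linarith)
        (le_trans (by gcongr; linarith) hmp) (hn₁.mono hR₁) ((hn₂.mono hB).mono hR₂)
        (hRc _ hc₁) (hRc _ hc₂) fun h h0 B' hB' => hk h h0 B' ((hB'.trans hR₂).trans hB)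
      have hI' : (crossings L₁ B : ℝ) ≤
          5 * d * (L₁.card + B.card) + k * L₁.card + crossings R₁ R₂ := by exact_mod_cast hI
      have hBm : (B.card : ℝ) ≤ m ^ 16 :=
        le_trans (by exact_mod_cast Finset.card_le_card hB) hL₂
      have e1 : 5 * (d : ℝ) * (L₁.card + B.card) ≤ 5 * (t ^ 8 / 2) * (m ^ 16 + m ^ 16) :=
        mul_le_mul (mul_le_mul_of_nonneg_left hd1 (by norm_num)) (add_le_add hL₁ hBm)
          (add_nonneg (Nat.cast_nonneg _) (Nat.cast_nonneg _)) (by positivity)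
      have e2 : (k : ℝ) * L₁.card ≤ k * m ^ 16 := by gcongr
      linarith
    set X : ℝ := 5 * m ^ 16 * t ^ 8 + k * m ^ 16 + 98 ^ 16 * (t ^ 24 + k * t ^ 17) with hX
    have hX0 : 0 ≤ X := by positivity
    clear_value X
    have hsplit := crossings_le_of_small_subsets hM0 (X := ⌊X⌋₊)
      fun B hB hBM => Nat.le_floor (hsmall B hB hBM)
    have h1' : (crossings L₁ L₂ : ℝ) ≤ (L₂.card / M + 1) * X := by
      calc (crossings L₁ L₂ : ℝ) ≤ (((L₂.card / M : ℕ) : ℝ) + 1) * ⌊X⌋₊ := by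
            exact_mod_cast hsplit
        _ ≤ _ := mul_le_mul (add_le_add_left Nat.cast_div_le 1) (Nat.floor_le hX0)
            (Nat.cast_nonneg _)
            (add_nonneg (div_nonneg (Nat.cast_nonneg _) (Nat.cast_nonneg _)) zero_le_one)
    have h2' : (L₂.card : ℝ) / M + 1 ≤ 49 * 98 ^ 16 := by
      have : (L₂.card : ℝ) / M ≤ 48 * 98 ^ 16 := by
        rw [div_le_iff₀ (by exact_mod_cast hM0)]
        calc (L₂.card : ℝ) ≤ m ^ 16 := hL₂
          _ = 48 * 98 ^ 16 * (t ^ 16 / 48) := by rw [hmt]; ring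
          _ ≤ _ := by gcongr
      linarith [show (1 : ℝ) ≤ 98 ^ 16 by norm_num]
    have h3' : (crossings L₁ L₂ : ℝ) ≤ 49 * 98 ^ 16 * X := h1'.trans (by gcongr)
    refine h3'.trans ?_
    rw [hX, hmt]
    have e24 : 0 ≤ t ^ 24 := by positivity
    have e17 : (k : ℝ) * t ^ 16 * 2 ≤ k * t ^ 17 := by
      rw [show t ^ 17 = t ^ 16 * t by ring, ← mul_assoc]
      gcongr
    have e16 : 0 ≤ (k : ℝ) * t ^ 17 := by positivity
    ring_nf
    ring_nf at e17
    linarith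

end Incidence

section Transfer

theorem card_le_two_of_quadratic {K : Type*} [Field K] {a b c : K} (ha : a ≠ 0) {s : Finset K}
    (h : ∀ x ∈ s, a * x ^ 2 + b * x + c = 0) : s.card ≤ 2 := by
  have hdeg := Polynomial.natDegree_quadratic (b := b) (c := c) ha
  set f : Polynomial K := .C a * .X ^ 2 + .C b * .X + .C c with hf
  have hf0 : f ≠ 0 := by
    rintro h0
    rw [h0] at hdeg
    simp at hdeg
  rw [← hdeg]
  refine le_trans ?_ (Polynomial.card_roots' f)
  refine Multiset.card_le_card (Finset.val_le_iff_val_subset.2 fun x hx => ?_)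
  rw [Polynomial.mem_roots hf0, Polynomial.IsRoot, hf]
  simpa using h x hx

variable {F K : Type*} [Field F] [Field K] [Algebra F K]

/-- The null line of the first family attached to a triple. -/
def firstLine (κ : K) (x : F × F × F) : K × K × K :=
  (algebraMap F K x.1, algebraMap F K x.2.2,
    algebraMap F K (x.1 * x.2.2 - x.1 * x.2.1) - κ * algebraMap F K x.1)

/-- The null line of the second family attached to a triple. -/
def secondLine (κ : K) (x : F × F × F) : K × K × K :=
  (algebraMap F K x.1, algebraMap F K x.2.2 + κ,
    algebraMap F K (x.1 * x.2.2 - x.1 * x.2.1) + κ * algebraMap F K x.1)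

open Classical in
theorem crossings_eq_card (L L' : Finset (K × K × K)) :
    crossings L L' = ((L ×ˢ L').filter fun x => Cross x.1 x.2).card := by
  simp only [crossings, crossers, Finset.card_filter, Finset.sum_product]

theorem eq_zero_of_add_mul_eq_zero {κ : K} (hκ : ∀ x : F, algebraMap F K x ≠ κ) {x y : F}
    (h : algebraMap F K x + κ * algebraMap F K y = 0) : x = 0 ∧ y = 0 := by
  have hy : y = 0 := by
    by_contra hy
    refine hκ (-x / y) ?_
    have : algebraMap F K y ≠ 0 := by simpa using hy
    rw [map_div₀, map_neg, div_eq_iff this]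
    linear_combination -h
  subst hy
  simpa using h

theorem cross_firstLine_secondLine (κ : K) {x y : F × F × F} :
    Cross (firstLine κ x) (secondLine κ y) ↔
      x.1 ≠ y.1 ∧ x.1 * (y.2.2 - x.2.1) = y.1 * (x.2.2 - y.2.1) := by
  simp only [Cross, firstLine, secondLine, ne_eq, (algebraMap F K).injective.eq_iff]
  refine and_congr_right fun _ => ?_
  rw [← (algebraMap F K).injective.eq_iff]
  simp only [map_mul, map_sub]
  constructor <;> intro h <;> linear_combination h

theorem nonCrossing_image_firstLine [DecidableEq K] {κ : K} (hκ : ∀ x : F, algebraMap F K x ≠ κ)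
    (T : Finset (F × F × F)) : NonCrossing (T.image (firstLine κ)) := by
  intro l hl l' hl' h
  obtain ⟨x, -, rfl⟩ := Finset.mem_image.1 hl
  obtain ⟨y, -, rfl⟩ := Finset.mem_image.1 hl'
  refine h.1 (congrArg (algebraMap F K) (sub_eq_zero.1 (eq_zero_of_add_mul_eq_zero hκ
    (x := (x.1 + y.1) * (x.2.2 - y.2.2) - (x.1 * x.2.2 - x.1 * x.2.1)
      + (y.1 * y.2.2 - y.1 * y.2.1)) (y := x.1 - y.1) ?_).2))
  have h2 := h.2
  simp only [firstLine, map_mul, map_sub, map_add] at h2 ⊢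
  linear_combination -h2

theorem nonCrossing_image_secondLine [DecidableEq K] {κ : K}
    (hκ : ∀ x : F, algebraMap F K x ≠ κ)
    (T : Finset (F × F × F)) : NonCrossing (T.image (secondLine κ)) := by
  intro l hl l' hl' h
  obtain ⟨x, -, rfl⟩ := Finset.mem_image.1 hl
  obtain ⟨y, -, rfl⟩ := Finset.mem_image.1 hl'
  refine h.1 (congrArg (algebraMap F K) (sub_eq_zero.1 (eq_zero_of_add_mul_eq_zero hκ
    (x := -(x.1 + y.1) * (x.2.2 - y.2.2) + (x.1 * x.2.2 - x.1 * x.2.1)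
      - (y.1 * y.2.2 - y.1 * y.2.1)) (y := x.1 - y.1) ?_).2))
  have h2 := h.2
  simp only [secondLine, map_mul, map_sub, map_add, map_neg] at h2 ⊢
  linear_combination h2

theorem firstLine_injOn (κ : K) {T : Set (F × F × F)} (hT : ∀ x ∈ T, x.1 ≠ 0) :
    Set.InjOn (firstLine κ) T := by
  rintro ⟨a, b, s⟩ hx ⟨a', b', s'⟩ - h
  simp only [firstLine, Prod.mk.injEq, (algebraMap F K).injective.eq_iff] at h
  obtain ⟨rfl, rfl, h⟩ := h
  rw [sub_left_inj, (algebraMap F K).injective.eq_iff, sub_right_inj] at h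
  rw [mul_left_cancel₀ (hT _ hx) h]

theorem secondLine_injOn (κ : K) {T : Set (F × F × F)} (hT : ∀ x ∈ T, x.1 ≠ 0) :
    Set.InjOn (secondLine κ) T := by
  rintro ⟨a, b, s⟩ hx ⟨a', b', s'⟩ - h
  simp only [secondLine, Prod.mk.injEq, (algebraMap F K).injective.eq_iff, add_left_inj] at h
  obtain ⟨rfl, rfl, h⟩ := h
  rw [add_left_inj, (algebraMap F K).injective.eq_iff, sub_right_inj] at h
  rw [mul_left_cancel₀ (hT _ hx) h]

theorem card_le_of_memSphere [DecidableEq K] (κ : K) (A B P : Finset F) {h : Fin 5 → K}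
    (h0 : h ≠ 0) {L : Finset (K × K × K)} (hL : L ⊆ (A ×ˢ B ×ˢ P).image (secondLine κ))
    (hs : ∀ l ∈ L, MemSphere h l) : L.card ≤ 2 * (A.card + B.card + P.card) := by
  have hcard : ∀ {f g : K × K × K → K} {S : Finset K} {n : ℕ}, S.card ≤ n → (∀ l ∈ L, f l ∈ S) →
      (∀ l ∈ L, ∀ l' ∈ L, f l = f l' → g l = g l' → l = l') →
      (∀ x ∈ S, ∃ a b c : K, a ≠ 0 ∧ ∀ l ∈ L, f l = x → a * g l ^ 2 + b * g l + c = 0) →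
      L.card ≤ 2 * n := by
    intro f g S n hS hf hinj hq
    refine (Finset.card_le_mul_card_image_of_maps_to hf 2 fun x hx => ?_).trans
      (Nat.mul_le_mul_left _ hS)
    obtain ⟨a, b, c, ha, hq⟩ := hq x hx
    rw [← Finset.card_image_of_injOn (f := g)]
    · refine card_le_two_of_quadratic ha (b := b) (c := c) fun y hy => ?_
      obtain ⟨l, hl, rfl⟩ := Finset.mem_image.1 hy
      rw [Finset.mem_filter] at hl
      exact hq l hl.1 hl.2
    · intro l hl l' hl' hg
      rw [Finset.mem_coe, Finset.mem_filter] at hl hl'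
      exact hinj l hl.1 l' hl'.1 (hl.2.trans hl'.2.symm) hg
  obtain rfl | ⟨l₀, hl₀⟩ := L.eq_empty_or_nonempty
  · simp
  by_cases ha : h 0 = 0
  · by_cases hd : h 3 = 0
    · have hc : h 2 ≠ 0 := by
        intro hc
        refine h0 (funext fun i => ?_)
        obtain ⟨e1, e2⟩ := hs l₀ hl₀
        rw [ha, hc, hd] at e1 e2
        simp only [zero_mul, zero_add, add_zero, neg_zero] at e1 e2
        fin_cases i <;> simp [ha, hc, hd, e1, e2]
      have hsub : L ⊆ B.image fun b => ((-h 1 / h 2, -h 4 / h 2,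
          (-h 1 / h 2) * (-h 4 / h 2) - (-h 1 / h 2) * algebraMap F K b) : K × K × K) := by
        intro l hl
        obtain ⟨⟨a, b, s⟩, hx, rfl⟩ := Finset.mem_image.1 (hL hl)
        obtain ⟨e1, e2⟩ := hs _ hl
        rw [Finset.mem_product, Finset.mem_product] at hx
        refine Finset.mem_image.2 ⟨b, hx.2.1, ?_⟩
        rw [ha, hd] at e1 e2
        have h1 : -h 1 / h 2 = algebraMap F K a := by
          rw [div_eq_iff hc]
          simp only [secondLine] at e1
          linear_combination -e1
        have h2 : -h 4 / h 2 = algebraMap F K s + κ := by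
          rw [div_eq_iff hc]
          simp only [secondLine] at e2
          linear_combination -e2
        simp only [h1, h2, secondLine, Prod.mk.injEq, true_and, map_sub, map_mul]
        ring
      have := (Finset.card_le_card hsub).trans Finset.card_image_le
      omega
    · refine (hcard (f := fun l => l.2.1) (g := fun l => l.1)
        (S := P.image fun s => algebraMap F K s + κ) (n := P.card) Finset.card_image_le
        ?_ ?_ ?_).trans (by omega)
      · intro l hl
        obtain ⟨x, hx, rfl⟩ := Finset.mem_image.1 (hL hl)
        rw [Finset.mem_product, Finset.mem_product] at hx
        exact Finset.mem_image_of_mem _ hx.2.2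
      · rintro ⟨t, u, v⟩ hl ⟨t', u', v'⟩ hl' hu ht
        obtain ⟨-, e1⟩ := hs _ hl
        obtain ⟨-, e2⟩ := hs _ hl'
        simp only at hu ht e1 e2
        subst hu ht
        rw [ha] at e1 e2
        rw [mul_left_cancel₀ hd (show h 3 * v = h 3 * v' by linear_combination e1 - e2)]
      · intro _ _
        refine ⟨h 3, h 2, h 1, hd, fun l hl _ => ?_⟩
        have := (hs l hl).1
        rw [ha] at this
        linear_combination this
  · refine (hcard (f := fun l => l.1) (g := fun l => l.2.1)
      (S := A.image (algebraMap F K)) (n := A.card) Finset.card_image_le ?_ ?_ ?_).trans (by omega)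
    · intro l hl
      obtain ⟨x, hx, rfl⟩ := Finset.mem_image.1 (hL hl)
      rw [Finset.mem_product] at hx
      exact Finset.mem_image_of_mem _ hx.1
    · rintro ⟨t, u, v⟩ hl ⟨t', u', v'⟩ hl' ht hu
      obtain ⟨e1, -⟩ := hs _ hl
      obtain ⟨e2, -⟩ := hs _ hl'
      simp only at hu ht e1 e2
      subst hu ht
      rw [mul_left_cancel₀ ha (show h 0 * v = h 0 * v' by linear_combination e1 - e2)]
    · intro t _
      refine ⟨-h 0 ^ 2, h 0 * h 2 + 2 * h 0 * h 3 * t,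
        h 0 * h 4 - h 3 * (h 1 + h 2 * t + h 3 * t ^ 2), by simpa using ha, fun l hl ht => ?_⟩
      obtain ⟨e1, e2⟩ := hs l hl
      subst ht
      linear_combination h 0 * e2 - h 3 * e1

end Transfer

section TripleEnergy

variable {F : Type*} [Field F] [DecidableEq F]

/-- The pairs of triples `(a, b, s)`, `(a', b', s')` with `a (s - b) = a' (s' - b')`. -/
def tripleEnergy (A B P : Finset F) : ℕ :=
  (((A ×ˢ B ×ˢ P) ×ˢ (A ×ˢ B ×ˢ P)).filter fun x =>
    x.1.1 * (x.1.2.2 - x.1.2.1) = x.2.1 * (x.2.2.2 - x.2.2.1)).card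

theorem card_filter_diag_le {A B P : Finset F} (hA : (0 : F) ∉ A) :
    (((A ×ˢ B ×ˢ P) ×ˢ (A ×ˢ B ×ˢ P)).filter fun x => x.1.1 = x.2.1 ∧
      x.1.1 * (x.1.2.2 - x.1.2.1) = x.2.1 * (x.2.2.2 - x.2.2.1)).card ≤
    A.card * B.card * P.card * B.card := by
  have : ((A ×ˢ B ×ˢ P) ×ˢ B).card = A.card * B.card * P.card * B.card := by
    simp only [Finset.card_product]; ring
  rw [← this]
  refine Finset.card_le_card_of_injOn (fun x => (x.1, x.2.2.1)) ?_ ?_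
  · intro x hx
    simp only [Finset.coe_filter, Set.mem_ofPred_eq, Finset.mem_product, Finset.mem_coe] at hx ⊢
    tauto
  · rintro ⟨⟨a, b, s⟩, ⟨a', b', s'⟩⟩ hx ⟨⟨c, d, r⟩, ⟨c', d', r'⟩⟩ hy h
    simp only [Finset.coe_filter, Set.mem_ofPred_eq, Finset.mem_product, Prod.mk.injEq] at hx hy h
    obtain ⟨⟨rfl, rfl, rfl⟩, rfl⟩ := h
    obtain ⟨⟨⟨ha, -⟩, -⟩, rfl, e1⟩ := hx
    obtain ⟨-, rfl, e2⟩ := hy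
    have ha0 : a ≠ 0 := fun h => hA (h ▸ ha)
    have := sub_left_injective (mul_left_cancel₀ ha0 (e1.symm.trans e2))
    rw [this]

theorem tripleEnergy_le {p : ℕ} [CharP F p] {A B P : Finset F} (hA : (0 : F) ∉ A) {m : ℝ}
    (h1 : 1 ≤ m) (hm : (A.card * B.card * P.card : ℝ) ≤ m ^ 16) (hmp : m ^ 16 ≤ (p : ℝ) ^ 2) :
    (tripleEnergy A B P : ℝ) ≤
      98 ^ 17 * (m ^ 24 + (A.card + B.card + P.card) * m ^ 17) := by
  classical
  let K := RatFunc F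
  let κ : K := RatFunc.X
  have hκ : ∀ x : F, algebraMap F K x ≠ κ := by
    intro x hx
    have hC : algebraMap (Polynomial F) K (Polynomial.C x) =
        algebraMap (Polynomial F) K Polynomial.X := by
      rw [RatFunc.algebraMap_C, RatFunc.algebraMap_X, ← RatFunc.algebraMap_eq_C]
      exact hx
    have := congrArg Polynomial.natDegree (RatFunc.algebraMap_injective F hC)
    simp at this
  have : Infinite K := Infinite.of_injective _ (RatFunc.algebraMap_injective F)
  have : CharP K p := charP_of_injective_algebraMap (algebraMap F K).injective p
  set T := A ×ˢ B ×ˢ P with hT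
  have hTc : T.card = A.card * B.card * P.card := by
    simp only [hT, Finset.card_product]; ring
  have hT0 : ∀ x ∈ (T : Set (F × F × F)), x.1 ≠ 0 := by
    intro x hx h0
    rw [Finset.mem_coe, hT, Finset.mem_product] at hx
    exact hA (h0 ▸ hx.1)
  have hTm : (T.card : ℝ) ≤ m ^ 16 := by
    rw [hTc]; exact_mod_cast hm
  obtain ⟨j, hj⟩ := pow_unbounded_of_one_lt m (show (1 : ℝ) < 98 by norm_num)
  have hmain := crossings_le_pow (k := 2 * (A.card + B.card + P.card)) j h1 hj.le hmp
    (nonCrossing_image_firstLine hκ T) (nonCrossing_image_secondLine hκ T)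
    ((Nat.cast_le.2 Finset.card_image_le).trans hTm)
    ((Nat.cast_le.2 Finset.card_image_le).trans hTm)
    fun h h0 L hL hs => card_le_of_memSphere κ A B P h0 hL hs
  have hoff : ((T ×ˢ T).filter fun x => x.1.1 ≠ x.2.1 ∧
      x.1.1 * (x.1.2.2 - x.1.2.1) = x.2.1 * (x.2.2.2 - x.2.2.1)).card ≤
      crossings (T.image (firstLine κ)) (T.image (secondLine κ)) := by
    rw [crossings_eq_card]
    refine Finset.card_le_card_of_injOn (fun x => (firstLine κ (x.1.1, x.1.2.1, x.2.2.2),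
      secondLine κ (x.2.1, x.2.2.1, x.1.2.2))) ?_ ?_
    · rintro ⟨⟨a, b, s⟩, ⟨a', b', s'⟩⟩ hx
      simp only [hT, Finset.coe_filter, Set.mem_ofPred_eq, Finset.mem_product] at hx ⊢
      refine ⟨⟨Finset.mem_image_of_mem _ ?_, Finset.mem_image_of_mem _ ?_⟩, ?_⟩
      · simp only [Finset.mem_product]
        tauto
      · simp only [Finset.mem_product]
        tauto
      · rw [cross_firstLine_secondLine]
        exact hx.2
    · rintro ⟨⟨a, b, s⟩, ⟨a', b', s'⟩⟩ hx ⟨⟨c, d, r⟩, ⟨c', d', r'⟩⟩ hy h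
      simp only [hT, Finset.coe_filter, Set.mem_ofPred_eq, Finset.mem_product] at hx hy
      have e1 := firstLine_injOn κ (T := {x | x.1 ≠ 0}) (fun x hx => hx)
        (fun h => hA (h ▸ hx.1.1.1)) (fun h => hA (h ▸ hy.1.1.1)) (congrArg Prod.fst h)
      have e2 := secondLine_injOn κ (T := {x | x.1 ≠ 0}) (fun x hx => hx)
        (fun h => hA (h ▸ hx.1.2.1)) (fun h => hA (h ▸ hy.1.2.1)) (congrArg Prod.snd h)
      simp only [Prod.mk.injEq] at e1 e2 ⊢
      tauto
  have hsplit : tripleEnergy A B P ≤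
      crossings (T.image (firstLine κ)) (T.image (secondLine κ)) + T.card * B.card := by
    refine le_trans ?_ (add_le_add hoff ((card_filter_diag_le hA).trans (by rw [hTc])))
    refine le_trans (Finset.card_le_card ?_) (Finset.card_union_le _ _)
    intro x hx
    rw [Finset.mem_union, Finset.mem_filter, Finset.mem_filter]
    rw [Finset.mem_filter] at hx
    tauto
  have hsplit' : (tripleEnergy A B P : ℝ) ≤
      crossings (T.image (firstLine κ)) (T.image (secondLine κ)) + T.card * B.card := by
    exact_mod_cast hsplit
  have e1 : (T.card : ℝ) * B.card ≤ m ^ 17 * (A.card + B.card + P.card) := by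
    refine mul_le_mul (hTm.trans (pow_le_pow_right₀ h1 (by norm_num))) ?_ (Nat.cast_nonneg _)
      (by positivity)
    linarith [Nat.cast_nonneg (α := ℝ) A.card, Nat.cast_nonneg (α := ℝ) P.card]
  have e2 : 0 ≤ (A.card + B.card + P.card : ℝ) * m ^ 17 :=
    mul_nonneg (by exact_mod_cast Nat.zero_le _) (by positivity)
  have e3 : 0 ≤ m ^ 24 := by positivity
  push_cast at hmain
  linarith

end TripleEnergy

section Dyadic

/-- The number of dyadic levels of the positive integers up to `N`. -/
def dyadicLevels (N : ℕ) : ℕ := Nat.log 2 N + 1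

theorem exists_dyadic_level {α : Type*} (S : Finset α) (f g : α → ℕ) {N : ℕ}
    (hf : ∀ x ∈ S, f x ≠ 0 ∧ f x ≤ N) :
    ∃ τ : ℕ, 0 < τ ∧ ∑ x ∈ S, g x ≤
      dyadicLevels N * ∑ x ∈ S with (τ ≤ f x ∧ f x < 2 * τ), g x := by
  classical
  by_contra! h
  have hmaps : ∀ x ∈ S, Nat.log 2 (f x) ∈ Finset.range (dyadicLevels N) := fun x hx =>
    Finset.mem_range.2 (Nat.lt_succ_of_le (Nat.log_mono_right (hf x hx).2))
  have hsum := Finset.sum_fiberwise_of_maps_to hmaps g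
  have hlevel : ∀ i ∈ Finset.range (dyadicLevels N),
      dyadicLevels N * ∑ x ∈ S with Nat.log 2 (f x) = i, g x < ∑ x ∈ S, g x := by
    intro i _
    have hi := h (2 ^ i) (by positivity)
    have hS : (S.filter fun x => Nat.log 2 (f x) = i) =
        S.filter fun x => 2 ^ i ≤ f x ∧ f x < 2 * 2 ^ i := by
      refine Finset.filter_congr fun x hx => ?_
      rw [Nat.log_eq_iff (Or.inr ⟨one_lt_two, (hf x hx).1⟩), pow_succ, mul_comm (2 ^ i) 2]
    rwa [hS]
  have hlt := Finset.sum_lt_sum_of_nonempty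
    (Finset.nonempty_range_iff.2 (show dyadicLevels N ≠ 0 from Nat.succ_ne_zero _)) hlevel
  rw [← Finset.mul_sum, hsum, Finset.sum_const, Finset.card_range, smul_eq_mul] at hlt
  exact lt_irrefl _ hlt

theorem card_filter_map_eq {α β : Type*} [DecidableEq β] (S : Finset α) (φ : α → β) :
    ((S ×ˢ S).filter fun x => φ x.1 = φ x.2).card =
      ∑ x ∈ S, (S.filter fun y => φ y = φ x).card := by
  rw [Finset.card_filter, Finset.sum_product]
  refine Finset.sum_congr rfl fun x _ => ?_
  rw [Finset.card_filter]
  simp only [eq_comm]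

theorem card_filter_mem {α β : Type*} [DecidableEq β] (S : Finset α) (φ : α → β)
    (Q : Finset β) : (S.filter fun x => φ x ∈ Q).card =
      ∑ q ∈ Q, (S.filter fun x => φ x = q).card := by
  rw [Finset.card_eq_sum_card_fiberwise (f := φ) (t := Q)]
  · refine Finset.sum_congr rfl fun q hq => ?_
    congr 1
    ext x
    simp only [Finset.mem_filter]
    constructor
    · tauto
    · rintro ⟨h1, rfl⟩
      tauto
  · intro x hx
    exact (Finset.mem_filter.1 hx).2

/-- The popular values of a map. -/
theorem exists_popular {α β : Type*} [DecidableEq β] (S : Finset α) (φ : α → β) {N : ℕ}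
    (hN : ∀ q, (S.filter fun x => φ x = q).card ≤ N) :
    ∃ Q : Finset β, ∃ σ : ℕ, 0 < σ ∧
      (∀ q ∈ Q, σ ≤ (S.filter fun x => φ x = q).card ∧ (S.filter fun x => φ x = q).card < 2 * σ) ∧
      ((S ×ˢ S).filter fun x => φ x.1 = φ x.2).card ≤
        2 * dyadicLevels N * σ * (S.filter fun x => φ x ∈ Q).card := by
  obtain ⟨σ, hσ, hsum⟩ := exists_dyadic_level S (fun x => (S.filter fun y => φ y = φ x).card)
    (fun x => (S.filter fun y => φ y = φ x).card) (N := N)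
    fun x hx => ⟨Finset.card_ne_zero.2 ⟨x, by simp [hx]⟩, hN _⟩
  refine ⟨(S.image φ).filter fun q => σ ≤ (S.filter fun x => φ x = q).card ∧
    (S.filter fun x => φ x = q).card < 2 * σ, σ, hσ, fun q hq => (Finset.mem_filter.1 hq).2, ?_⟩
  rw [card_filter_map_eq]
  refine hsum.trans ?_
  rw [show ∀ a b : ℕ, 2 * a * σ * b = a * (b * (2 * σ)) from fun a b => by ring]
  refine Nat.mul_le_mul_left _ ?_
  refine (Finset.sum_le_card_nsmul _ _ (2 * σ) fun x hx => ?_).trans ?_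
  · exact (Finset.mem_filter.1 hx).2.2.le
  · rw [smul_eq_mul]
    refine Nat.mul_le_mul_right _ (Finset.card_le_card fun x hx => ?_)
    rw [Finset.mem_filter] at hx ⊢
    exact ⟨hx.1, Finset.mem_filter.2 ⟨Finset.mem_image_of_mem _ hx.1, hx.2⟩⟩

theorem sq_card_filter_le {α β : Type*} [DecidableEq β] (S : Finset α) (φ : α → β)
    (Q : Finset β) : (S.filter fun x => φ x ∈ Q).card ^ 2 ≤
      Q.card * ((S ×ˢ S).filter fun x => φ x.1 = φ x.2).card := by
  rw [card_filter_mem]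
  refine (sq_sum_le_card_mul_sum_sq).trans (Nat.mul_le_mul_left _ ?_)
  calc ∑ q ∈ Q, (S.filter fun x => φ x = q).card ^ 2
      = ∑ q ∈ Q, (((S ×ˢ S).filter fun x => φ x.1 = φ x.2).filter
          fun x => φ x.1 = q).card := by
        refine Finset.sum_congr rfl fun q _ => ?_
        rw [sq, ← Finset.card_product]
        congr 1
        ext x
        simp only [Finset.mem_product, Finset.mem_filter]
        constructor
        · rintro ⟨⟨h1, h2⟩, h3, h4⟩
          exact ⟨⟨⟨h1, h3⟩, h2.trans h4.symm⟩, h2⟩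
        · rintro ⟨⟨⟨h1, h3⟩, h2⟩, h4⟩
          exact ⟨⟨h1, h4⟩, h3, h2.symm.trans h4⟩
    _ = (((S ×ˢ S).filter fun x => φ x.1 = φ x.2).filter fun x => φ x.1 ∈ Q).card :=
        (card_filter_mem _ (fun x : α × α => φ x.1) Q).symm
    _ ≤ _ := Finset.card_filter_le _ _

end Dyadic

section Energy

theorem addEnergy_eq {α : Type*} [Add α] [DecidableEq α] (A : Finset α) : addEnergy A =
    (((A ×ˢ A) ×ˢ (A ×ˢ A)).filter fun x => x.1.1 + x.1.2 = x.2.1 + x.2.2).card := by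
  refine Finset.card_equiv (Equiv.prodAssoc α α (α × α)).symm fun x => ?_
  simp [and_assoc]

theorem mulEnergy_eq {α : Type*} [Mul α] [DecidableEq α] (A : Finset α) : mulEnergy A =
    (((A ×ˢ A) ×ˢ (A ×ˢ A)).filter fun x => x.1.1 * x.1.2 = x.2.1 * x.2.2).card := by
  refine Finset.card_equiv (Equiv.prodAssoc α α (α × α)).symm fun x => ?_
  simp [and_assoc]

variable {F : Type*} [Field F] [DecidableEq F]

theorem card_filter_add_eq_le (B : Finset F) (s : F) :
    ((B ×ˢ B).filter fun x => x.1 + x.2 = s).card ≤ B.card := by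
  refine Finset.card_le_card_of_injOn Prod.fst ?_ ?_
  · intro x hx
    simp only [Finset.coe_filter, Set.mem_ofPred_eq, Finset.mem_product] at hx
    exact hx.1.1
  · intro x hx y hy h
    simp only [Finset.coe_filter, Set.mem_ofPred_eq, Finset.mem_product] at hx hy
    refine Prod.ext h ?_
    have := hx.2.trans hy.2.symm
    rw [h] at this
    exact add_left_cancel this

theorem card_filter_mul_eq_le {B : Finset F} (hB : (0 : F) ∉ B) (s : F) :
    ((B ×ˢ B).filter fun x => x.1 * x.2 = s).card ≤ B.card := by
  refine Finset.card_le_card_of_injOn Prod.fst ?_ ?_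
  · intro x hx
    simp only [Finset.coe_filter, Set.mem_ofPred_eq, Finset.mem_product] at hx
    exact hx.1.1
  · intro x hx y hy h
    simp only [Finset.coe_filter, Set.mem_ofPred_eq, Finset.mem_product] at hx hy
    refine Prod.ext h ?_
    have := hx.2.trans hy.2.symm
    rw [h] at this
    exact mul_left_cancel₀ (fun h0 => hB (h0 ▸ hy.1.1)) this

end Energy

section Regularization

theorem card_filter_product_eq_sum {α β : Type*} (S : Finset α) (T : Finset β)
    (r : α → β → Prop) [DecidableRel r] :
    ((S ×ˢ T).filter fun x => r x.1 x.2).card = ∑ a ∈ S, (T.filter (r a)).card := by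
  simp only [Finset.card_filter, Finset.sum_product]

theorem sum_degree_le {α : Type*} {R S : Finset α} (hS : S ⊆ R) (f : α → ℕ) {D : ℕ}
    (hf : ∀ x ∈ S, D ≤ f x) : S.card * D ≤ ∑ x ∈ R, f x := by
  rw [← smul_eq_mul]
  exact (Finset.card_nsmul_le_sum _ _ _ hf).trans (Finset.sum_le_sum_of_subset hS)

/-- In a symmetric relation some level of the degrees carries many edges. -/
theorem exists_regular_subsets {α : Type*} [DecidableEq α] (R : Finset α) (r : α → α → Prop)
    [DecidableRel r] (hr : ∀ a b, r a b → r b a) {N : ℕ} (hN : R.card ≤ N) :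
    ∃ A ⊆ R, ∃ B ⊆ R, ∃ D : ℕ, 0 < D ∧ (B.Nonempty → D ≤ N) ∧
      ((R ×ˢ R).filter fun x => r x.1 x.2).card ≤ 8 * dyadicLevels N * D * B.card ∧
      A.card * D ≤ ((R ×ˢ R).filter fun x => r x.1 x.2).card ∧
      B.card * D ≤ ((R ×ˢ R).filter fun x => r x.1 x.2).card ∧
      ∀ b ∈ B, D ≤ 4 * dyadicLevels N * (A.filter (r b)).card := by
  set G := (R ×ˢ R).filter fun x => r x.1 x.2 with hG
  let deg : α → ℕ := fun c => (R.filter (r c)).card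
  have hGdeg : G.card = ∑ c ∈ R, deg c := card_filter_product_eq_sum R R r
  set G' := G.filter fun x => deg x.1 ≤ deg x.2 with hG'
  have hhalf : G.card ≤ 2 * G'.card := by
    have h1 : G.card = G'.card + (G.filter fun x => ¬ deg x.1 ≤ deg x.2).card :=
      (Finset.card_filter_add_card_filter_not _).symm
    have h2 : (G.filter fun x => ¬ deg x.1 ≤ deg x.2).card ≤ G'.card := by
      refine Finset.card_le_card_of_injOn Prod.swap ?_ Prod.swap_injective.injOn
      intro x hx
      simp only [hG', hG, Finset.coe_filter, Finset.mem_filter, Set.mem_ofPred_eq,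
        Finset.mem_product, Prod.fst_swap, Prod.snd_swap] at hx ⊢
      exact ⟨⟨⟨hx.1.1.2, hx.1.1.1⟩, hr _ _ hx.1.2⟩, by omega⟩
    omega
  obtain ⟨D, hD, hlevel⟩ := exists_dyadic_level G' (fun x => deg x.1) (fun _ => 1) (N := N) (by
    intro x hx
    simp only [hG', hG, Finset.mem_filter, Finset.mem_product] at hx
    refine ⟨Finset.card_ne_zero.2 ⟨x.2, ?_⟩, (Finset.card_filter_le _ _).trans hN⟩
    exact Finset.mem_filter.2 ⟨hx.1.1.2, hx.1.2⟩)
  set X := R.filter fun c => D ≤ deg c ∧ deg c < 2 * D with hX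
  set A := R.filter fun c => D ≤ deg c with hA
  set B := X.filter fun c => D ≤ 4 * dyadicLevels N * (A.filter (r c)).card with hB
  have hXR : X ⊆ R := Finset.filter_subset _ _
  have hAR : A ⊆ R := Finset.filter_subset _ _
  have hBX : B ⊆ X := Finset.filter_subset _ _
  have hdeg : ∀ c ∈ X, D ≤ deg c := fun c hc => (Finset.mem_filter.1 hc).2.1
  have hedges : G'.card ≤ dyadicLevels N * ∑ c ∈ X, (A.filter (r c)).card := by
    rw [← Finset.card_eq_sum_ones, ← Finset.card_eq_sum_ones] at hlevel
    refine hlevel.trans (Nat.mul_le_mul_left _ ?_)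
    rw [← card_filter_product_eq_sum]
    refine Finset.card_le_card fun x hx => ?_
    simp only [hG', hG, hX, hA, Finset.mem_filter, Finset.mem_product] at hx ⊢
    obtain ⟨⟨⟨⟨h1, h2⟩, h3⟩, h4⟩, h5⟩ := hx
    exact ⟨⟨⟨h1, h5⟩, h2, h5.1.trans h4⟩, h3⟩
  have hsmall : 4 * dyadicLevels N * ∑ c ∈ X \ B, (A.filter (r c)).card ≤ G.card := by
    rw [hGdeg]
    refine le_trans ?_ (sum_degree_le hXR deg hdeg)
    rw [Finset.mul_sum]
    refine (Finset.sum_le_card_nsmul _ _ D fun c hc => ?_).trans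
      (Nat.mul_le_mul_right _ (Finset.card_le_card Finset.sdiff_subset))
    rw [Finset.mem_sdiff] at hc
    exact (not_le.1 fun h => hc.2 (Finset.mem_filter.2 ⟨hc.1, h⟩)).le
  have hlarge : ∑ c ∈ B, (A.filter (r c)).card ≤ B.card * (2 * D) := by
    refine Finset.sum_le_card_nsmul _ _ _ fun c hc => ?_
    exact (Finset.card_le_card (Finset.filter_subset_filter _ hAR)).trans
      (Finset.mem_filter.1 (hBX hc)).2.2.le
  have hsplit := Finset.sum_sdiff hBX (f := fun c => (A.filter (r c)).card)
  refine ⟨A, hAR, B, hBX.trans hXR, D, hD, ?_, ?_, ?_, ?_, fun b hb => (Finset.mem_filter.1 hb).2⟩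
  · rintro ⟨b, hb⟩
    exact (hdeg b (hBX hb)).trans ((Finset.card_filter_le _ _).trans hN)
  · have h1 := Nat.mul_le_mul_left (4 * dyadicLevels N) hlarge
    rw [← hsplit, mul_add] at hedges
    linarith
  · exact (sum_degree_le hAR deg fun c hc => (Finset.mem_filter.1 hc).2).trans_eq hGdeg.symm
  · exact (sum_degree_le (hBX.trans hXR) deg fun c hc => hdeg c (hBX hc)).trans_eq hGdeg.symm

end Regularization

section Numerics

theorem le_pow_seven_of_sq_mul_le {a m ν n : ℝ} (hm : 0 < m) (hmν : m ≤ ν)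
    (hn : m ^ 16 = n) (h : a ^ 2 * ν ^ 2 ≤ n) : a ≤ m ^ 7 := by
  refine le_of_sq_le_sq ?_ (by positivity)
  have h1 : a ^ 2 * m ^ 2 ≤ (m ^ 7) ^ 2 * m ^ 2 := by
    calc a ^ 2 * m ^ 2 ≤ a ^ 2 * ν ^ 2 := by gcongr
      _ ≤ m ^ 16 := by rw [hn]; exact h
      _ = _ := by ring
  exact le_of_mul_le_mul_right h1 (by positivity)

theorem numeric_size_bounds {L Λ ν E G D a b x τ S : ℝ} (hL : 1 ≤ L) (hΛ : Λ = 2 ^ 60 * L)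
    (hν : 1 ≤ ν) (hD : 0 < D) (hb : 0 < b) (ha0 : 0 ≤ a) (hx : 0 < x) (hτ : 0 < τ)
    (hE : Λ ^ 4 * ν ^ 14 ≤ E) (hEG : E ≤ 2 * L * ν ^ 5 * G) (hGb : G ≤ 8 * L * D * b)
    (haG : a * D ≤ G) (hDν : D ≤ ν ^ 5) (hDa : D ≤ 4 * L * a) (hbν : b ≤ ν ^ 5)
    (hS : Λ ^ 4 * b ^ 4 < S * ν ^ 6) (hSx : S ≤ 4 * L * τ ^ 2 * x) (hxτ : x * τ ≤ b ^ 2)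
    (hτb : τ ≤ b) :
    Λ * ν ^ 4 ≤ b ∧ Λ * ν ^ 4 ≤ a ∧ a ≤ 8 * L * b ∧ x ≤ ν ^ 6 ∧ Λ ^ 3 * b ^ 2 ≤ x * ν ^ 6 := by
  have hL0 : 0 < L := by linarith
  have hΛ0 : 0 < Λ := by rw [hΛ]; positivity
  have hν0 : 0 < ν := by linarith
  have h16 : 64 * L ≤ Λ := by rw [hΛ]; linarith
  have hΛ1 : 1 ≤ Λ := by linarith
  have hL3 : 64 * L ^ 3 ≤ Λ ^ 3 := by
    calc 64 * L ^ 3 ≤ (64 * L) ^ 3 := by ring_nf; nlinarith [pow_pos hL0 3]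
      _ ≤ _ := by gcongr
  have hL23 : L ^ 2 ≤ L ^ 3 := pow_le_pow_right₀ hL (by norm_num)
  refine ⟨?_, ?_, ?_, ?_, ?_⟩
  · have h1 : Λ ^ 3 * ν ^ 10 * (Λ * ν ^ 4) ≤ Λ ^ 3 * ν ^ 10 * b := by
      calc Λ ^ 3 * ν ^ 10 * (Λ * ν ^ 4) = Λ ^ 4 * ν ^ 14 := by ring
        _ ≤ 2 * L * ν ^ 5 * G := hE.trans hEG
        _ ≤ 2 * L * ν ^ 5 * (8 * L * ν ^ 5 * b) := by gcongr; exact hGb.trans (by gcongr)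
        _ = 16 * L ^ 2 * (ν ^ 10 * b) := by ring
        _ ≤ Λ ^ 3 * (ν ^ 10 * b) := by gcongr; linarith [pow_pos hL0 3]
        _ = _ := by ring
    exact le_of_mul_le_mul_left h1 (by positivity)
  · have h1 : Λ ^ 3 * ν ^ 10 * (Λ * ν ^ 4) ≤ Λ ^ 3 * ν ^ 10 * a := by
      calc Λ ^ 3 * ν ^ 10 * (Λ * ν ^ 4) = Λ ^ 4 * ν ^ 14 := by ring
        _ ≤ 2 * L * ν ^ 5 * G := hE.trans hEG
        _ ≤ 2 * L * ν ^ 5 * (8 * L * (4 * L * a) * ν ^ 5) := by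
          gcongr; exact hGb.trans (by gcongr)
        _ = 64 * L ^ 3 * (ν ^ 10 * a) := by ring
        _ ≤ Λ ^ 3 * (ν ^ 10 * a) := by gcongr
        _ = _ := by ring
    exact le_of_mul_le_mul_left h1 (by positivity)
  · refine le_of_mul_le_mul_right ((haG.trans hGb).trans_eq ?_) hD
    ring
  · have h1 : Λ * b ^ 4 * x ≤ Λ * b ^ 4 * ν ^ 6 := by
      calc Λ * b ^ 4 * x ≤ Λ ^ 4 * b ^ 4 * x := by
            gcongr; exact le_self_pow₀ hΛ1 (by norm_num)
        _ ≤ S * ν ^ 6 * x := by gcongr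
        _ ≤ 4 * L * τ ^ 2 * x * ν ^ 6 * x := by gcongr
        _ = 4 * L * (x * τ) ^ 2 * ν ^ 6 := by ring
        _ ≤ Λ * (b ^ 2) ^ 2 * ν ^ 6 := by gcongr; linarith
        _ = _ := by ring
    exact le_of_mul_le_mul_left h1 (by positivity)
  · have h1 : Λ * b ^ 2 * (Λ ^ 3 * b ^ 2) ≤ Λ * b ^ 2 * (x * ν ^ 6) := by
      calc Λ * b ^ 2 * (Λ ^ 3 * b ^ 2) = Λ ^ 4 * b ^ 4 := by ring
        _ ≤ S * ν ^ 6 := hS.le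
        _ ≤ 4 * L * τ ^ 2 * x * ν ^ 6 := by gcongr
        _ ≤ Λ * b ^ 2 * x * ν ^ 6 := by gcongr; linarith
        _ = _ := by ring
    exact le_of_mul_le_mul_left h1 (by positivity)

theorem numeric_energy_bound {L E G D a b x τ S g T X C : ℝ} (hL : 1 ≤ L) (hD : 0 < D)
    (hb : 0 < b) (ha0 : 0 ≤ a) (hx : 0 < x) (hτ : 0 < τ) (hE0 : 0 ≤ E) (hG0 : 0 ≤ G)
    (hg0 : 0 ≤ g) (hS0 : 0 ≤ S) (hEg : E * g ≤ 2 * L * G ^ 2)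
    (hGb : G ≤ 8 * L * D * b) (hab : a ≤ 8 * L * b) (hSx : S ≤ 4 * L * τ ^ 2 * x)
    (hxτ : x * τ ≤ b ^ 2) (hT : x * τ * D ≤ 4 * L * T) (hTX : T ^ 2 ≤ g * X)
    (hX : X ^ 2 ≤ C ^ 2 * (a * b * x) ^ 3) :
    E ^ 2 * S ^ 3 ≤ 2 ^ 37 * C ^ 2 * L ^ 16 * b ^ 14 := by
  have hL0 : 0 < L := by linarith
  have h1 : x * τ ^ 4 * D ^ 4 ≤ 2 ^ 17 * C ^ 2 * L ^ 7 * b ^ 6 * g ^ 2 := by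
    have h : x ^ 3 * (x * τ ^ 4 * D ^ 4) ≤
        x ^ 3 * (2 ^ 17 * C ^ 2 * L ^ 7 * b ^ 6 * g ^ 2) := by
      calc x ^ 3 * (x * τ ^ 4 * D ^ 4) = (x * τ * D) ^ 4 := by ring
        _ ≤ (4 * L * T) ^ 4 := by gcongr
        _ = 256 * L ^ 4 * (T ^ 2) ^ 2 := by ring
        _ ≤ 256 * L ^ 4 * (g * X) ^ 2 := by gcongr
        _ = 256 * L ^ 4 * g ^ 2 * X ^ 2 := by ring
        _ ≤ 256 * L ^ 4 * g ^ 2 * (C ^ 2 * (8 * L * b * b * x) ^ 3) := by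
          gcongr; exact hX.trans (by gcongr)
        _ = _ := by ring
    exact le_of_mul_le_mul_left h (by positivity)
  have h2 : E ^ 2 * g ^ 2 ≤ 2 ^ 14 * L ^ 6 * D ^ 4 * b ^ 4 := by
    have hEg' : E * g ≤ 2 * L * (8 * L * D * b) ^ 2 := hEg.trans (by gcongr)
    calc E ^ 2 * g ^ 2 = (E * g) ^ 2 := by ring
      _ ≤ (2 * L * (8 * L * D * b) ^ 2) ^ 2 := pow_le_pow_left₀ (by positivity) hEg' 2
      _ = _ := by ring
  have h3 : E ^ 2 * (x * τ ^ 4) ≤ 2 ^ 31 * C ^ 2 * L ^ 13 * b ^ 10 := by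
    have h : D ^ 4 * (E ^ 2 * (x * τ ^ 4)) ≤ D ^ 4 * (2 ^ 31 * C ^ 2 * L ^ 13 * b ^ 10) := by
      calc D ^ 4 * (E ^ 2 * (x * τ ^ 4)) = E ^ 2 * (x * τ ^ 4 * D ^ 4) := by ring
        _ ≤ E ^ 2 * (2 ^ 17 * C ^ 2 * L ^ 7 * b ^ 6 * g ^ 2) := by gcongr
        _ = 2 ^ 17 * C ^ 2 * L ^ 7 * b ^ 6 * (E ^ 2 * g ^ 2) := by ring
        _ ≤ 2 ^ 17 * C ^ 2 * L ^ 7 * b ^ 6 * (2 ^ 14 * L ^ 6 * D ^ 4 * b ^ 4) := by gcongr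
        _ = _ := by ring
    exact le_of_mul_le_mul_left h (by positivity)
  calc E ^ 2 * S ^ 3 ≤ E ^ 2 * (4 * L * τ ^ 2 * x) ^ 3 := by gcongr
    _ = 64 * L ^ 3 * (x * τ) ^ 2 * (E ^ 2 * (x * τ ^ 4)) := by ring
    _ ≤ 64 * L ^ 3 * (b ^ 2) ^ 2 * (2 ^ 31 * C ^ 2 * L ^ 13 * b ^ 10) := by gcongr
    _ = _ := by ring

theorem numeric_contradiction {L Λ ν E G D a b x τ S g T X : ℝ} (hL : 1 ≤ L)
    (hΛ : Λ = 2 ^ 60 * L) (hν : 1 ≤ ν) (hD : 0 < D) (hb : 0 < b) (ha0 : 0 ≤ a) (hx : 0 < x)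
    (hτ : 0 < τ) (hG0 : 0 ≤ G) (hg0 : 0 ≤ g) (hX0 : 0 ≤ X)
    (hE : Λ ^ 4 * ν ^ 14 ≤ E) (hEG : E ≤ 2 * L * ν ^ 5 * G) (hEg : E * g ≤ 2 * L * G ^ 2)
    (hGb : G ≤ 8 * L * D * b)
    (haG : a * D ≤ G) (hDν : D ≤ ν ^ 5) (hDa : D ≤ 4 * L * a) (haν : a ≤ ν ^ 5) (hbν : b ≤ ν ^ 5)
    (hS : Λ ^ 4 * b ^ 4 < S * ν ^ 6) (hSx : S ≤ 4 * L * τ ^ 2 * x) (hxτ : x * τ ≤ b ^ 2)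
    (hτb : τ ≤ b) (hT : x * τ * D ≤ 4 * L * T) (hTX : T ^ 2 ≤ g * X)
    (hX : ∀ m : ℝ, 1 ≤ m → a * b * x ≤ m ^ 16 → m ≤ ν →
      X ≤ 98 ^ 17 * (m ^ 24 + (a + b + x) * m ^ 17)) : False := by
  obtain ⟨hbl, hal, hab, hxu, hxl⟩ := numeric_size_bounds hL hΛ hν hD hb ha0 hx hτ hE hEG hGb haG
    hDν hDa hbν hS hSx hxτ hτb
  have hL0 : 0 < L := by linarith
  have hΛ0 : 0 < Λ := by rw [hΛ]; positivity
  have hν0 : 0 < ν := by linarith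
  have h8 : 8 * L ≤ Λ := by rw [hΛ]; linarith
  have hΛ1 : 1 ≤ Λ := by linarith
  have ha : 0 < a := lt_of_lt_of_le (by positivity) hal
  have hνb : ν ^ 4 ≤ b := le_trans (le_mul_of_one_le_left (by positivity) hΛ1) hbl
  have hνa : ν ^ 4 ≤ a := le_trans (le_mul_of_one_le_left (by positivity) hΛ1) hal
  have hn0 : 0 < a * b * x := by positivity
  obtain ⟨m, hm0, hm⟩ : ∃ m : ℝ, 0 < m ∧ m ^ 16 = a * b * x :=
    ⟨(a * b * x) ^ ((16 : ℕ) : ℝ)⁻¹, by positivity, Real.rpow_inv_natCast_pow hn0.le (by norm_num)⟩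
  have hmν : m ≤ ν := by
    refine le_of_pow_le_pow_left₀ (n := 16) (by norm_num) hν0.le ?_
    calc m ^ 16 = a * b * x := hm
      _ ≤ ν ^ 5 * ν ^ 5 * ν ^ 6 := by gcongr
      _ = _ := by ring
  have ham : a ≤ m ^ 7 := by
    refine le_pow_seven_of_sq_mul_le hm0 hmν hm ?_
    have h : a * b * ν ^ 6 * (a ^ 2 * ν ^ 2) ≤ a * b * ν ^ 6 * (a * b * x) := by
      calc a * b * ν ^ 6 * (a ^ 2 * ν ^ 2) = a ^ 2 * b * ν ^ 4 * a * ν ^ 4 := by ring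
        _ ≤ a ^ 2 * b * b * (8 * L * b) * b := by gcongr
        _ ≤ a ^ 2 * b * b * (Λ ^ 3 * b) * b := by
          gcongr; exact h8.trans (le_self_pow₀ hΛ1 (by norm_num))
        _ = a ^ 2 * b ^ 2 * (Λ ^ 3 * b ^ 2) := by ring
        _ ≤ a ^ 2 * b ^ 2 * (x * ν ^ 6) := by gcongr
        _ = _ := by ring
    exact le_of_mul_le_mul_left h (by positivity)
  have hxl' : b ^ 2 ≤ x * ν ^ 6 :=
    le_trans (le_mul_of_one_le_left (by positivity) (one_le_pow₀ hΛ1)) hxl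
  have hbm : b ≤ m ^ 7 := by
    refine le_pow_seven_of_sq_mul_le hm0 hmν hm ?_
    have h : ν ^ 6 * (b ^ 2 * ν ^ 2) ≤ ν ^ 6 * (a * b * x) := by
      calc ν ^ 6 * (b ^ 2 * ν ^ 2) = ν ^ 4 * ν ^ 4 * b ^ 2 := by ring
        _ ≤ a * b * (x * ν ^ 6) := by gcongr
        _ = _ := by ring
    exact le_of_mul_le_mul_left h (by positivity)
  have hxm : x ≤ m ^ 7 := by
    refine le_pow_seven_of_sq_mul_le hm0 hmν hm ?_
    calc x ^ 2 * ν ^ 2 = x * ν ^ 2 * x := by ring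
      _ ≤ ν ^ 6 * ν ^ 2 * x := by gcongr
      _ = ν ^ 4 * ν ^ 4 * x := by ring
      _ ≤ a * b * x := by gcongr
  have hm1 : 1 ≤ m := by
    have : 1 ≤ m ^ 7 := (one_le_pow₀ hν).trans (hνb.trans hbm)
    by_contra! h
    exact absurd this (not_le.2 (pow_lt_one₀ hm0.le h (by norm_num)))
  have hX1 : X ≤ 4 * 98 ^ 17 * m ^ 24 := by
    have h1 : (a + b + x) * m ^ 17 ≤ (m ^ 7 + m ^ 7 + m ^ 7) * m ^ 17 := by gcongr
    have h2 := hX m hm1 hm.ge hmν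
    have h3 : (m ^ 7 + m ^ 7 + m ^ 7) * m ^ 17 = 3 * m ^ 24 := by ring
    linarith
  have hX2 : X ^ 2 ≤ (4 * 98 ^ 17) ^ 2 * (a * b * x) ^ 3 := by
    calc X ^ 2 ≤ (4 * 98 ^ 17 * m ^ 24) ^ 2 := by gcongr
      _ = (4 * 98 ^ 17) ^ 2 * (m ^ 16) ^ 3 := by ring
      _ = _ := by rw [hm]
  have hS0 : 0 < S := by
    have : 0 < S * ν ^ 6 := lt_trans (by positivity) hS
    exact pos_of_mul_pos_left this (by positivity)
  have hE0 : 0 < E := lt_of_lt_of_le (by positivity) hE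
  have hfin := numeric_energy_bound hL hD hb ha0 hx hτ hE0.le hG0 hg0 hS0.le hEg hGb hab hSx hxτ
    hT hTX hX2
  have h1 : (Λ ^ 4 * ν ^ 14) ^ 2 * (Λ ^ 4 * b ^ 4) ^ 3 < E ^ 2 * (S * ν ^ 6) ^ 3 := by
    refine mul_lt_mul' ?_ ?_ (by positivity) (by positivity)
    · gcongr
    · gcongr
  obtain ⟨Q, hQ⟩ : ∃ Q : ℝ, Q = 2 ^ 60 := ⟨_, rfl⟩
  have hQ0 : 0 < Q := by rw [hQ]; positivity
  have h2 : b ^ 12 * ν ^ 28 * Λ ^ 20 < b ^ 12 * ν ^ 28 * L ^ 20 * Q ^ 20 := by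
    calc b ^ 12 * ν ^ 28 * Λ ^ 20 = (Λ ^ 4 * ν ^ 14) ^ 2 * (Λ ^ 4 * b ^ 4) ^ 3 := by ring
      _ < E ^ 2 * (S * ν ^ 6) ^ 3 := h1
      _ = E ^ 2 * S ^ 3 * ν ^ 18 := by ring
      _ ≤ 2 ^ 37 * (4 * 98 ^ 17) ^ 2 * L ^ 16 * b ^ 14 * ν ^ 18 := by gcongr
      _ = 2 ^ 37 * (4 * 98 ^ 17) ^ 2 * L ^ 16 * b ^ 12 * b ^ 2 * ν ^ 18 := by ring
      _ ≤ Q ^ 20 * L ^ 20 * b ^ 12 * (ν ^ 5) ^ 2 * ν ^ 18 := by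
        have hC : (2 : ℝ) ^ 37 * (4 * 98 ^ 17) ^ 2 ≤ Q ^ 20 := by
          calc (2 : ℝ) ^ 37 * (4 * 98 ^ 17) ^ 2 ≤ Q * (Q ^ 2) ^ 2 := by
                refine mul_le_mul ?_ (pow_le_pow_left₀ (by positivity) ?_ 2) (by positivity) ?_ <;>
                  rw [hQ] <;> norm_num
            _ = Q ^ 5 := by ring
            _ ≤ Q ^ 20 := pow_le_pow_right₀ (by rw [hQ]; norm_num) (by norm_num)
        have hLp : L ^ 16 ≤ L ^ 20 := pow_le_pow_right₀ hL (by norm_num)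
        have hb2 : b ^ 2 ≤ (ν ^ 5) ^ 2 := pow_le_pow_left₀ hb.le hbν 2
        refine mul_le_mul_of_nonneg_right (mul_le_mul (mul_le_mul_of_nonneg_right
          (mul_le_mul hC hLp ?_ ?_) ?_) hb2 ?_ ?_) ?_ <;> positivity
      _ = _ := by ring
  have h3 : Λ ^ 20 = L ^ 20 * Q ^ 20 := by rw [hΛ, ← hQ]; ring
  rw [h3, ← mul_assoc] at h2
  exact lt_irrefl _ h2

end Numerics

section KeyLemma

variable {F : Type*} [Field F] [DecidableEq F]

theorem card_mul_le_card_triples {A B P Q : Finset F} {D k : ℕ}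
    (h : ∀ b ∈ B, D ≤ k * (A.filter fun a => b * a ∈ Q).card) :
    ((B ×ˢ B).filter fun x => x.1 + x.2 ∈ P).card * D ≤
      k * ((A ×ˢ B ×ˢ P).filter fun x => x.1 * (x.2.2 - x.2.1) ∈ Q).card := by
  set W := (B ×ˢ B).filter fun x => x.1 + x.2 ∈ P with hW
  calc W.card * D ≤ ∑ w ∈ W, k * (A.filter fun a => w.2 * a ∈ Q).card := by
        rw [← smul_eq_mul]
        refine Finset.card_nsmul_le_sum _ _ _ fun w hw => h _ ?_
        rw [hW, Finset.mem_filter, Finset.mem_product] at hw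
        exact hw.1.2
    _ = k * ((W ×ˢ A).filter fun x => x.1.2 * x.2 ∈ Q).card := by
        rw [← Finset.mul_sum, card_filter_product_eq_sum W A fun w a => w.2 * a ∈ Q]
    _ ≤ _ := by
        refine Nat.mul_le_mul_left _ (Finset.card_le_card_of_injOn
          (fun x => (x.2, x.1.1, x.1.1 + x.1.2)) ?_ ?_)
        · rintro ⟨⟨b, b'⟩, a⟩ hx
          simp only [hW, Finset.coe_filter, Set.mem_ofPred_eq, Finset.mem_product,
            Finset.mem_filter] at hx ⊢
          rw [add_sub_cancel_left, mul_comm]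
          tauto
        · rintro ⟨⟨b, b'⟩, a⟩ - ⟨⟨c, c'⟩, d⟩ - h
          simp only [Prod.mk.injEq] at h ⊢
          obtain ⟨rfl, rfl, h⟩ := h
          exact ⟨⟨rfl, add_left_cancel h⟩, rfl⟩

/-- A set with large multiplicative energy contains a nonempty set with small additive energy. -/
theorem exists_subset_addEnergy_le {p : ℕ} [CharP F p] {R : Finset F}
    (h0 : (0 : F) ∉ R) {N : ℕ} (hN : R.card ≤ N) {ν Λ : ℝ} (hν : 1 ≤ ν) (hNν : (N : ℝ) = ν ^ 5)
    (hp : ν ^ 16 ≤ (p : ℝ) ^ 2) (hΛ : Λ = 2 ^ 60 * dyadicLevels N)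
    (hE : Λ ^ 4 * ν ^ 14 ≤ mulEnergy R) :
    ∃ B ⊆ R, B.Nonempty ∧ addEnergy B * ν ^ 6 ≤ Λ ^ 4 * (B.card : ℝ) ^ 4 := by
  have hL : (1 : ℝ) ≤ dyadicLevels N := by
    exact_mod_cast Nat.succ_le_succ (Nat.zero_le _)
  have hΛ0 : 0 < Λ := by rw [hΛ]; positivity
  have hE0 : 0 < mulEnergy R := by
    have : (0 : ℝ) < mulEnergy R := lt_of_lt_of_le (by positivity) hE
    exact_mod_cast this
  obtain ⟨Q, σ, hσ, hQ, hEσ⟩ := exists_popular (R ×ˢ R) (fun x => x.1 * x.2) (N := N)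
    fun q => (card_filter_mul_eq_le h0 q).trans hN
  rw [← mulEnergy_eq] at hEσ
  obtain ⟨A, hAR, B, hBR, D, hD, hDN, hGb, haG, -, hDa⟩ := exists_regular_subsets R
    (fun a b => a * b ∈ Q) (fun a b h => by rwa [mul_comm]) hN
  set G := ((R ×ˢ R).filter fun x => x.1 * x.2 ∈ Q).card with hG
  have hG0 : 0 < G := Nat.pos_of_ne_zero fun h => by rw [h] at hEσ; omega
  have hB : B.Nonempty := by
    rw [Finset.nonempty_iff_ne_empty]
    rintro rfl
    rw [Finset.card_empty, mul_zero] at hGb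
    omega
  refine ⟨B, hBR, hB, ?_⟩
  by_contra! hS
  have hQσ : Q.card * σ ≤ G := by
    rw [hG, card_filter_mem, ← smul_eq_mul]
    exact Finset.card_nsmul_le_sum _ _ _ fun q hq => (hQ q hq).1
  have hσN : σ ≤ N := by
    obtain ⟨q, hq⟩ : Q.Nonempty := by
      rw [Finset.nonempty_iff_ne_empty]
      rintro rfl
      simp [hG] at hG0
    exact (hQ q hq).1.trans ((card_filter_mul_eq_le h0 q).trans hN)
  have hBN : B.card ≤ N := (Finset.card_le_card hBR).trans hN
  have hAN : A.card ≤ N := (Finset.card_le_card hAR).trans hN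
  obtain ⟨P, τ, hτ, hP, hSτ⟩ := exists_popular (B ×ˢ B) (fun x => x.1 + x.2) (N := N)
    fun q => (card_filter_add_eq_le B q).trans hBN
  rw [← addEnergy_eq] at hSτ
  set W := ((B ×ˢ B).filter fun x => x.1 + x.2 ∈ P).card with hW
  have hS0 : 0 < addEnergy B := by
    have h1 : 0 < addEnergy B * ν ^ 6 := lt_of_le_of_lt (by positivity) hS
    have : (0 : ℝ) < addEnergy B := pos_of_mul_pos_left h1 (by positivity)
    exact_mod_cast this
  have hW0 : 0 < W := Nat.pos_of_ne_zero fun h => by rw [h] at hSτ; omega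
  obtain ⟨s, hs⟩ : P.Nonempty := by
    rw [Finset.nonempty_iff_ne_empty]
    rintro rfl
    simp [hW] at hW0
  have hτB : τ ≤ B.card := (hP s hs).1.trans (card_filter_add_eq_le B s)
  have hPτ : P.card * τ ≤ W := by
    rw [hW, card_filter_mem, ← smul_eq_mul]
    exact Finset.card_nsmul_le_sum _ _ _ fun q hq => (hP q hq).1
  have hWP : W ≤ P.card * (2 * τ) := by
    rw [hW, card_filter_mem]
    exact Finset.sum_le_card_nsmul _ _ _ fun q hq => (hP q hq).2.le
  have hWB : W ≤ B.card ^ 2 := by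
    rw [sq, ← Finset.card_product]
    exact Finset.card_filter_le _ _
  have hT := card_mul_le_card_triples (P := P) hDa
  have hTX := sq_card_filter_le (A ×ˢ B ×ˢ P) (fun x => x.1 * (x.2.2 - x.2.1)) Q
  have hA0 : (0 : F) ∉ A := fun h => h0 (hAR h)
  obtain ⟨b, hb⟩ := hB
  have hDa' : D ≤ 4 * dyadicLevels N * A.card :=
    (hDa b hb).trans (Nat.mul_le_mul_left _ (Finset.card_filter_le _ _))
  have hbpos : 0 < B.card := Finset.card_pos.2 ⟨b, hb⟩
  have hPpos : 0 < P.card := Finset.card_pos.2 ⟨s, hs⟩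
  refine numeric_contradiction (L := dyadicLevels N) (E := mulEnergy R) (G := G) (D := D)
    (a := A.card) (b := B.card) (x := P.card) (τ := τ) (S := addEnergy B) (g := Q.card)
    (T := ((A ×ˢ B ×ˢ P).filter fun x => x.1 * (x.2.2 - x.2.1) ∈ Q).card)
    (X := tripleEnergy A B P) hL hΛ hν (by exact_mod_cast hD) (by exact_mod_cast hbpos)
    (Nat.cast_nonneg _) (by exact_mod_cast hPpos) (by exact_mod_cast hτ) (Nat.cast_nonneg _)
    (Nat.cast_nonneg _) (Nat.cast_nonneg _) hE ?_ ?_ (by exact_mod_cast hGb)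
    (by exact_mod_cast haG) ?_ (by exact_mod_cast hDa') ?_ ?_ hS ?_ ?_ (by exact_mod_cast hτB)
    ?_ (by exact_mod_cast hTX) ?_
  · rw [← hNν]
    exact_mod_cast hEσ.trans (by gcongr)
  · have h : mulEnergy R * Q.card ≤ 2 * dyadicLevels N * G ^ 2 := by
      calc mulEnergy R * Q.card ≤ 2 * dyadicLevels N * σ * G * Q.card := by gcongr
        _ = 2 * dyadicLevels N * G * (Q.card * σ) := by ring
        _ ≤ 2 * dyadicLevels N * G * G := by gcongr
        _ = _ := by ring
    exact_mod_cast h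
  · rw [← hNν]
    exact_mod_cast hDN ⟨b, hb⟩
  · rw [← hNν]
    exact_mod_cast hAN
  · rw [← hNν]
    exact_mod_cast hBN
  · have h : addEnergy B ≤ 4 * dyadicLevels N * τ ^ 2 * P.card := by
      calc addEnergy B ≤ 2 * dyadicLevels N * τ * W := hSτ
        _ ≤ 2 * dyadicLevels N * τ * (P.card * (2 * τ)) := by gcongr
        _ = _ := by ring
    exact_mod_cast h
  · exact_mod_cast hPτ.trans hWB
  · exact_mod_cast (Nat.mul_le_mul_right D hPτ).trans hT
  · intro m hm1 hm hmν
    refine tripleEnergy_le hA0 hm1 hm (le_trans ?_ hp)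
    gcongr

end KeyLemma

section EnergySubadditivity

variable {G : Type*} [AddCommGroup G] [DecidableEq G]

theorem addEnergy_eq_finset_addEnergy (A : Finset G) : addEnergy A = Finset.addEnergy A A := by
  rw [addEnergy_eq, Finset.addEnergy_eq_card_filter]

theorem finset_addEnergy_eq_sum_sub [Fintype G] (A B : Finset G) : Finset.addEnergy A B =
    ∑ d, ((A ×ˢ A).filter fun x => x.1 - x.2 = d).card *
      ((B ×ˢ B).filter fun x => x.1 - x.2 = d).card := by
  rw [Finset.addEnergy, Finset.card_eq_sum_card_fiberwise
    (f := fun x : (G × G) × G × G => x.1.1 - x.1.2) (t := Finset.univ) (by simp)]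
  refine Finset.sum_congr rfl fun d _ => ?_
  rw [← Finset.card_product]
  refine Finset.card_bij' (fun x _ => (x.1, x.2.swap)) (fun x _ => (x.1, x.2.swap)) ?_ ?_
    (by simp) (by simp)
  · rintro ⟨⟨a, b⟩, c, e⟩ h
    simp only [Finset.mem_filter, Finset.mem_product, Prod.swap] at h ⊢
    obtain ⟨⟨⟨⟨ha, hb⟩, hc, he⟩, h1⟩, rfl⟩ := h
    refine ⟨⟨⟨ha, hb⟩, rfl⟩, ⟨he, hc⟩, ?_⟩
    rw [sub_eq_sub_iff_add_eq_add, add_comm e b, h1]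
  · rintro ⟨⟨a, b⟩, c, e⟩ h
    simp only [Finset.mem_filter, Finset.mem_product, Prod.swap] at h ⊢
    obtain ⟨⟨⟨ha, hb⟩, h1⟩, ⟨hc, he⟩, h2⟩ := h
    refine ⟨⟨⟨⟨ha, hb⟩, he, hc⟩, ?_⟩, h1⟩
    rw [← h2, sub_eq_sub_iff_add_eq_add] at h1
    rw [h1, add_comm]

theorem sq_finset_addEnergy_le [Fintype G] (A B : Finset G) :
    Finset.addEnergy A B ^ 2 ≤ Finset.addEnergy A A * Finset.addEnergy B B := by
  simp only [finset_addEnergy_eq_sum_sub, ← sq]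
  exact Finset.sum_mul_sq_le_sq_mul_sq _ _ _

theorem card_filter_add_union {V B : Finset G} (h : Disjoint V B) (z : G) :
    (((V ∪ B) ×ˢ (V ∪ B)).filter fun x => x.1 + x.2 = z).card =
      ((V ×ˢ V).filter fun x => x.1 + x.2 = z).card +
        2 * ((V ×ˢ B).filter fun x => x.1 + x.2 = z).card +
        ((B ×ˢ B).filter fun x => x.1 + x.2 = z).card := by
  have hc : ((B ×ˢ V).filter fun x => x.1 + x.2 = z).card =
      ((V ×ˢ B).filter fun x => x.1 + x.2 = z).card := by
    refine Finset.card_bij' (fun x _ => x.swap) (fun x _ => x.swap) ?_ ?_ (by simp) (by simp) <;>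
    · simp only [Finset.mem_filter, Finset.mem_product, Prod.swap]
      rintro x ⟨⟨h1, h2⟩, rfl⟩
      exact ⟨⟨h2, h1⟩, add_comm _ _⟩
  rw [two_mul]
  nth_rewrite 1 [← hc]
  simp only [Finset.card_filter, Finset.sum_product, Finset.sum_union h, Finset.sum_add_distrib]
  ring

theorem sum_mul_le_of_sum_sq_le {ι : Type*} (s : Finset ι) (f g : ι → ℝ) {u v : ℝ} (hu : 0 ≤ u)
    (hv : 0 ≤ v) (hf : ∑ i ∈ s, f i ^ 2 ≤ u ^ 2) (hg : ∑ i ∈ s, g i ^ 2 ≤ v ^ 2) :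
    ∑ i ∈ s, f i * g i ≤ u * v := by
  refine le_of_abs_le (abs_le_of_sq_le_sq ?_ (mul_nonneg hu hv))
  rw [mul_pow]
  exact (Finset.sum_mul_sq_le_sq_mul_sq s f g).trans
    (mul_le_mul hf hg (Finset.sum_nonneg fun _ _ => sq_nonneg _) (sq_nonneg _))

/-- The fourth root of the additive energy is subadditive under disjoint unions. -/
theorem addEnergy_union_le [Fintype G] {V B : Finset G} (h : Disjoint V B) {x y : ℝ}
    (hx : 0 ≤ x) (hy : 0 ≤ y) (hV : addEnergy V ≤ x ^ 4) (hB : addEnergy B ≤ y ^ 4) :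
    addEnergy (V ∪ B) ≤ (x + y) ^ 4 := by
  have hVB : (Finset.addEnergy V B : ℝ) ≤ (x * y) ^ 2 := by
    refine le_of_abs_le (abs_le_of_sq_le_sq ?_ (sq_nonneg _))
    rw [addEnergy_eq_finset_addEnergy] at hV hB
    calc (Finset.addEnergy V B : ℝ) ^ 2
        ≤ Finset.addEnergy V V * Finset.addEnergy B B := by
          exact_mod_cast sq_finset_addEnergy_le V B
      _ ≤ x ^ 4 * y ^ 4 := by gcongr
      _ = _ := by ring
  set r : Finset G → Finset G → G → ℝ :=
    fun S T z => (((S ×ˢ T).filter fun x => x.1 + x.2 = z).card : ℝ) with hr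
  have hsq : ∀ S T, ∑ z, r S T z ^ 2 = Finset.addEnergy S T := fun S T => by
    rw [Finset.addEnergy_eq_sum_sq]
    push_cast
    rfl
  have h1 : ∑ z, r V V z ^ 2 ≤ (x ^ 2) ^ 2 := by
    rw [hsq, ← addEnergy_eq_finset_addEnergy, ← pow_mul]
    exact hV
  have h2 : ∑ z, r V B z ^ 2 ≤ (x * y) ^ 2 := by rwa [hsq]
  have h3 : ∑ z, r B B z ^ 2 ≤ (y ^ 2) ^ 2 := by
    rw [hsq, ← addEnergy_eq_finset_addEnergy, ← pow_mul]
    exact hB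
  have hx2 := sq_nonneg x
  have hy2 := sq_nonneg y
  have hxy := mul_nonneg hx hy
  have h12 := sum_mul_le_of_sum_sq_le _ _ _ hx2 hxy h1 h2
  have h13 := sum_mul_le_of_sum_sq_le _ _ _ hx2 hy2 h1 h3
  have h23 := sum_mul_le_of_sum_sq_le _ _ _ hxy hy2 h2 h3
  have hu : ∑ z, r (V ∪ B) (V ∪ B) z ^ 2 = ∑ z, r V V z ^ 2 + 4 * ∑ z, r V B z ^ 2 +
      ∑ z, r B B z ^ 2 + 4 * ∑ z, r V V z * r V B z + 2 * ∑ z, r V V z * r B B z +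
      4 * ∑ z, r V B z * r B B z := by
    simp only [Finset.mul_sum, ← Finset.sum_add_distrib]
    refine Finset.sum_congr rfl fun z _ => ?_
    simp only [hr, card_filter_add_union h z]
    push_cast
    ring
  rw [addEnergy_eq_finset_addEnergy, ← hsq, hu]
  linear_combination h1 + 4 * h2 + h3 + 4 * h12 + 2 * h13 + 4 * h23

end EnergySubadditivity

section Decomposition

variable {F : Type*} [Field F] [Fintype F] [DecidableEq F]

/-- A set without zero splits into a part of small additive energy and a part of small
multiplicative energy. -/
theorem exists_addEnergy_le_mulEnergy_lt {p : ℕ} [CharP F p] {A : Finset F} (h0 : (0 : F) ∉ A)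
    {N : ℕ} (hN : A.card ≤ N) {ν Λ : ℝ} (hν : 1 ≤ ν) (hNν : (N : ℝ) = ν ^ 5)
    (hp : ν ^ 16 ≤ (p : ℝ) ^ 2) (hΛ : Λ = 2 ^ 60 * dyadicLevels N) :
    ∃ V ⊆ A, addEnergy V ≤ Λ ^ 4 * ν ^ 14 ∧ mulEnergy (A \ V) < Λ ^ 4 * ν ^ 14 := by
  have hν0 : 0 < ν := zero_lt_one.trans_le hν
  have hΛ0 : 0 ≤ Λ := by rw [hΛ]; positivity
  obtain ⟨κ, hκ0, hκ⟩ : ∃ κ : ℝ, 0 ≤ κ ∧ κ ^ 4 * ν ^ 6 = Λ ^ 4 := by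
    have hs := Real.sq_sqrt hν0.le
    refine ⟨Λ / (ν * √ν), by positivity, ?_⟩
    have h4 : (ν * √ν) ^ 4 = ν ^ 6 := by
      rw [mul_pow, show (√ν) ^ 4 = (√ν ^ 2) ^ 2 by ring, hs]
      ring
    rw [div_pow, h4, div_mul_cancel₀ _ (by positivity)]
  obtain ⟨V, hV, hmax⟩ := Finset.exists_max_image
    (A.powerset.filter fun V => (addEnergy V : ℝ) ≤ (κ * V.card) ^ 4) Finset.card
    ⟨∅, Finset.mem_filter.2 ⟨Finset.empty_mem_powerset A, by simp [addEnergy]⟩⟩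
  simp only [Finset.mem_filter, Finset.mem_powerset] at hV hmax
  refine ⟨V, hV.1, ?_, ?_⟩
  · refine hV.2.trans ?_
    have hVN : (V.card : ℝ) ≤ ν ^ 5 := by
      rw [← hNν]
      exact_mod_cast (Finset.card_le_card hV.1).trans hN
    calc (κ * V.card) ^ 4 ≤ (κ * ν ^ 5) ^ 4 := by gcongr
      _ = (κ ^ 4 * ν ^ 6) * ν ^ 14 := by ring
      _ = _ := by rw [hκ]
  · by_contra! hE
    obtain ⟨B, hBR, hBne, hB⟩ := exists_subset_addEnergy_le
      (fun h => h0 (Finset.sdiff_subset h)) ((Finset.card_le_card Finset.sdiff_subset).trans hN)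
      hν hNν hp hΛ hE
    have hdisj : Disjoint V B := Finset.disjoint_sdiff.mono_right hBR
    have hB' : (addEnergy B : ℝ) ≤ (κ * B.card) ^ 4 := by
      refine le_of_mul_le_mul_right ?_ (pow_pos hν0 6)
      calc addEnergy B * ν ^ 6 ≤ Λ ^ 4 * (B.card : ℝ) ^ 4 := hB
        _ = _ := by rw [← hκ]; ring
    have hle := hmax (V ∪ B) ⟨Finset.union_subset hV.1 (hBR.trans Finset.sdiff_subset), by
      rw [Finset.card_union_of_disjoint hdisj, Nat.cast_add, mul_add]
      exact addEnergy_union_le hdisj (by positivity) (by positivity) hV.2 hB'⟩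
    rw [Finset.card_union_of_disjoint hdisj] at hle
    have := hBne.card_pos
    omega

theorem addEnergy_insert_le {V : Finset F} {a : F} (h : a ∉ V) {x : ℝ} (hx : 1 ≤ x)
    (hV : addEnergy V ≤ x ^ 4) : addEnergy (insert a V) ≤ 16 * x ^ 4 := by
  have h1 : (addEnergy ({a} : Finset F) : ℝ) ≤ x ^ 4 := by
    have : addEnergy ({a} : Finset F) = 1 := by simp [addEnergy, Finset.filter_singleton]
    rw [this, Nat.cast_one]
    exact one_le_pow₀ hx
  have h2 := addEnergy_union_le (Finset.disjoint_singleton_left.2 h) (by linarith) (by linarith)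
    h1 hV
  rw [← Finset.insert_eq] at h2
  linear_combination h2

theorem exists_subset_min_energy_le {p : ℕ} [CharP F p] (A : Finset F) {ν Λ : ℝ} (hν : 1 ≤ ν)
    (hNν : (A.card : ℝ) = ν ^ 5) (hp : ν ^ 16 ≤ (p : ℝ) ^ 2)
    (hΛ : Λ = 2 ^ 60 * dyadicLevels A.card) :
    ∃ A' ⊆ A, (A.card : ℝ) / 2 ≤ A'.card ∧
      (min (addEnergy A') (mulEnergy A') : ℝ) ≤ 16 * (Λ ^ 4 * ν ^ 14) := by
  have hL : (1 : ℝ) ≤ dyadicLevels A.card := by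
    exact_mod_cast Nat.succ_le_succ (Nat.zero_le (Nat.log 2 A.card))
  have hΛ1 : 1 ≤ Λ := by
    rw [hΛ]
    exact one_le_mul_of_one_le_of_one_le (one_le_pow₀ one_le_two) hL
  have hM1 : 1 ≤ Λ ^ 4 * ν ^ 14 :=
    one_le_mul_of_one_le_of_one_le (one_le_pow₀ hΛ1) (one_le_pow₀ hν)
  obtain ⟨x, hx1, hx⟩ : ∃ x : ℝ, 1 ≤ x ∧ x ^ 4 = Λ ^ 4 * ν ^ 14 := by
    refine ⟨√√(Λ ^ 4 * ν ^ 14), Real.one_le_sqrt.2 (Real.one_le_sqrt.2 hM1), ?_⟩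
    rw [show ∀ y : ℝ, y ^ 4 = (y ^ 2) ^ 2 from fun y => by ring,
      Real.sq_sqrt (Real.sqrt_nonneg _), Real.sq_sqrt (by linarith)]
  obtain ⟨V, hVA, hV, hR⟩ := exists_addEnergy_le_mulEnergy_lt (p := p) (A := A.erase 0) (by simp)
    (Finset.card_le_card (A.erase_subset 0)) hν hNν hp hΛ
  have hRA : A.erase 0 \ V ⊆ A := Finset.sdiff_subset.trans (A.erase_subset 0)
  obtain hc | hc := le_total ((A.card : ℝ) / 2) (A.erase 0 \ V).card
  · exact ⟨_, hRA, hc, (min_le_right _ _).trans (by linarith)⟩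
  · refine ⟨A \ (A.erase 0 \ V), Finset.sdiff_subset, ?_, (min_le_left _ _).trans ?_⟩
    · rw [Finset.card_sdiff_of_subset hRA, Nat.cast_sub (Finset.card_le_card hRA)]
      linarith
    · have h0V : (0 : F) ∉ V := fun h => by simpa using hVA h
      have hsub : A \ (A.erase 0 \ V) ⊆ insert 0 V := by
        intro a
        simp only [Finset.mem_sdiff, Finset.mem_erase, Finset.mem_insert]
        tauto
      have hmono : addEnergy (A \ (A.erase 0 \ V)) ≤ addEnergy (insert 0 V) :=
        Finset.card_le_card (Finset.filter_subset_filter _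
          (by gcongr))
      rw [← hx] at hV ⊢
      exact (Nat.cast_le.2 hmono).trans (addEnergy_insert_le h0V hx1 hV)

end Decomposition

theorem dyadicLevels_le_log {N : ℕ} (hN : 2 ≤ N) : (dyadicLevels N : ℝ) ≤ 4 * Real.log N := by
  have h2 := Real.log_two_gt_d9
  have hlog : Real.log 2 ≤ Real.log N := Real.log_le_log (by norm_num) (by exact_mod_cast hN)
  have hpow : Real.log ((2 : ℝ) ^ Nat.log 2 N) ≤ Real.log N :=
    Real.log_le_log (by positivity) (by exact_mod_cast Nat.pow_log_le_self 2 (by omega))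
  rw [Real.log_pow] at hpow
  have : (0 : ℝ) ≤ Nat.log 2 N := Nat.cast_nonneg _
  rw [dyadicLevels, Nat.cast_add, Nat.cast_one]
  nlinarith

theorem rss_energy_sum_product_prime_field :
    ∃ C > (0 : ℝ), ∃ c ≥ (0 : ℝ), ∀ p : ℕ, p.Prime → ∀ A : Finset (ZMod p),
      2 ≤ A.card → (A.card : ℝ) ≤ (p : ℝ) ^ ((5 : ℝ) / 8) →
      ∃ A' ⊆ A, (A.card : ℝ) / 2 ≤ A'.card ∧
        (min (addEnergy A') (mulEnergy A') : ℝ) ≤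
          C * (A.card : ℝ) ^ ((3 : ℝ) - 1 / 5) * (Real.log A.card) ^ c := by
  refine ⟨16 * (2 ^ 60 * 4) ^ 4, by positivity, 4, by norm_num, fun p hp A hA hAp => ?_⟩
  have : Fact p.Prime := ⟨hp⟩
  have hN0 : (0 : ℝ) ≤ A.card := Nat.cast_nonneg _
  have hN1 : (1 : ℝ) ≤ A.card := by exact_mod_cast one_le_two.trans hA
  set ν : ℝ := (A.card : ℝ) ^ ((1 : ℝ) / 5) with hν
  have hνpow : ∀ k : ℕ, ν ^ k = (A.card : ℝ) ^ ((k : ℝ) / 5) := fun k => by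
    rw [hν, ← Real.rpow_mul_natCast hN0]
    congr 1
    ring
  obtain ⟨A', hA', hcard, hmin⟩ := exists_subset_min_energy_le (p := p) A (ν := ν)
    (Real.one_le_rpow hN1 (by norm_num)) (by rw [hνpow]; norm_num) (by
      rw [hνpow]
      refine (Real.rpow_le_rpow hN0 hAp (by positivity)).trans_eq ?_
      rw [← Real.rpow_mul (Nat.cast_nonneg p), ← Real.rpow_natCast]
      norm_num) rfl
  refine ⟨A', hA', hcard, hmin.trans ?_⟩
  have h14 : (A.card : ℝ) ^ ((3 : ℝ) - 1 / 5) = ν ^ 14 := by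
    rw [hνpow]
    norm_num
  rw [h14, show (4 : ℝ) = ((4 : ℕ) : ℝ) by norm_num, Real.rpow_natCast]
  have hL := dyadicLevels_le_log hA
  calc 16 * ((2 ^ 60 * (dyadicLevels A.card : ℝ)) ^ 4 * ν ^ 14)
      ≤ 16 * ((2 ^ 60 * (4 * Real.log A.card)) ^ 4 * ν ^ 14) := by gcongr
    _ = _ := by push_cast; ring
end

section
/- There exists a constant c > 0 such that for every integer N ≥ 2, the set {1, 2, …, N} contains a bi-Sidon subset S with |S| ≥ c · N^{1/2} / log N. -/
/-- A set is additive Sidon if all pairwise sums are distinct. -/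
def IsAddSidon {α : Type*} [Add α] (S : Set α) : Prop :=
  ∀ a ∈ S, ∀ b ∈ S, ∀ a' ∈ S, ∀ b' ∈ S, a + b = a' + b' → ({a, b} : Set α) = {a', b'}

/-- A set is multiplicative Sidon if all pairwise products are distinct. -/
def IsMulSidon {α : Type*} [Mul α] (S : Set α) : Prop :=
  ∀ a ∈ S, ∀ b ∈ S, ∀ a' ∈ S, ∀ b' ∈ S, a * b = a' * b' → ({a, b} : Set α) = {a', b'}

/-- A set is bi-Sidon if it is both additive and multiplicative Sidon. -/
def IsBiSidon {α : Type*} [Add α] [Mul α] (S : Set α) : Prop :=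
  IsAddSidon S ∧ IsMulSidon S

/-- A set of naturals lying in a translate of an additive Sidon set is additive Sidon. -/
theorem IsAddSidon.of_translate {A S : Set ℕ} (hA : IsAddSidon A) {m s : ℕ}
    (h : ∀ x ∈ S, ∃ a ∈ A, x + m = s + a) : IsAddSidon S := by
  intro x hx y hy x' hx' y' hy' hsum
  obtain ⟨a, ha, hxa⟩ := h x hx
  obtain ⟨b, hb, hyb⟩ := h y hy
  obtain ⟨a', ha', hxa'⟩ := h x' hx'
  obtain ⟨b', hb', hyb'⟩ := h y' hy'
  have := hA a ha b hb a' ha' b' hb' (by omega)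
  rw [Set.pair_eq_pair_iff] at this ⊢
  omega

/-- Any set of primes is multiplicative Sidon. -/
theorem isMulSidon_of_forall_prime {S : Set ℕ} (h : ∀ q ∈ S, q.Prime) : IsMulSidon S := by
  intro a ha b hb a' ha' b' hb' hprod
  rw [Set.pair_eq_pair_iff]
  have hdvd : a ∣ a' * b' := hprod ▸ dvd_mul_right a b
  rcases (h a ha).dvd_mul.1 hdvd with hd | hd
  · obtain rfl := (Nat.prime_dvd_prime_iff_eq (h a ha) (h a' ha')).1 hd
    exact Or.inl ⟨rfl, Nat.eq_of_mul_eq_mul_left (h a ha).pos hprod⟩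
  · obtain rfl := (Nat.prime_dvd_prime_iff_eq (h a ha) (h b' hb')).1 hd
    rw [mul_comm a' a] at hprod
    exact Or.inr ⟨rfl, Nat.eq_of_mul_eq_mul_left (h a ha).pos hprod⟩

/-- The Erdős–Turán function `k ↦ 2pk + (k² mod p)`. -/
def erdosTuran (p k : ℕ) : ℕ := 2 * p * k + k ^ 2 % p

theorem erdosTuran_lt {p k : ℕ} (hk : k < p) : erdosTuran p k < 2 * p ^ 2 := by
  have := Nat.mod_lt (k ^ 2) (by omega : 0 < p)
  unfold erdosTuran
  nlinarith

theorem erdosTuran_injective {p : ℕ} (hp : 0 < p) : Function.Injective (erdosTuran p) := by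
  have hdiv (k : ℕ) : erdosTuran p k / (2 * p) = k := by
    have := Nat.mod_lt (k ^ 2) hp
    rw [erdosTuran, Nat.mul_add_div (by omega), Nat.div_eq_of_lt (by omega), add_zero]
  exact Function.LeftInverse.injective (g := (· / (2 * p))) hdiv

theorem isAddSidon_erdosTuran {p : ℕ} (hp : p.Prime) (hp2 : p ≠ 2) :
    IsAddSidon (erdosTuran p '' Set.Iio p) := by
  have : Fact p.Prime := ⟨hp⟩
  rintro _ ⟨k, hk, rfl⟩ _ ⟨l, hl, rfl⟩ _ ⟨k', hk', rfl⟩ _ ⟨l', hl', rfl⟩ h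
  simp only [Set.mem_Iio] at hk hl hk' hl'
  unfold erdosTuran at h
  have hlt (j : ℕ) : j ^ 2 % p < p := Nat.mod_lt _ hp.pos
  have h₁ : k + l = k' + l' := by
    have hdiv (i j : ℕ) : (2 * p * i + i ^ 2 % p + (2 * p * j + j ^ 2 % p)) / (2 * p) = i + j := by
      have hi := hlt i
      have hj := hlt j
      rw [show 2 * p * i + i ^ 2 % p + (2 * p * j + j ^ 2 % p) =
          2 * p * (i + j) + (i ^ 2 % p + j ^ 2 % p) by ring,
        Nat.mul_add_div (by omega), Nat.div_eq_of_lt (by omega), add_zero]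
    rw [← hdiv k l, h, hdiv]
  have h₂ : k ^ 2 % p + l ^ 2 % p = k' ^ 2 % p + l' ^ 2 % p := by
    have : 2 * p * (k + l) = 2 * p * (k' + l') := by rw [h₁]
    linarith
  have hsq : (k : ZMod p) ^ 2 + l ^ 2 = k' ^ 2 + l' ^ 2 := by
    simpa using congrArg (Nat.cast : ℕ → ZMod p) h₂
  have hsum : (k : ZMod p) + l = k' + l' := mod_cast congrArg (Nat.cast : ℕ → ZMod p) h₁
  have htwo : (2 : ZMod p) ≠ 0 := Ring.two_ne_zero (by rwa [ZMod.ringChar_zmod_n])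
  have hfac : (2 : ZMod p) * ((k - k') * (k - l')) = 0 := by
    have hl : (l : ZMod p) = k' + l' - k := by linear_combination hsum
    rw [hl] at hsq
    linear_combination hsq
  have hinj {i j : ℕ} (hi : i < p) (hj : j < p) (hij : (i : ZMod p) - j = 0) : i = j := by
    rw [sub_eq_zero, ZMod.natCast_eq_natCast_iff] at hij
    exact hij.eq_of_lt_of_lt hi hj
  rcases mul_eq_zero.1 ((mul_eq_zero.1 hfac).resolve_left htwo) with h₃ | h₃
  · obtain rfl := hinj hk hk' h₃
    rw [Nat.add_left_cancel h₁]
  · obtain rfl := hinj hk hl' h₃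
    rw [show l = k' by omega, Set.pair_comm]

theorem tenth_mul_div_log_le_primeCounting {N : ℕ} (hN : 2 ≤ N) :
    (N : ℝ) / 10 / Real.log N ≤ Nat.primeCounting N := by
  have hN' : (2 : ℝ) ≤ N := mod_cast hN
  refine le_trans ?_ (Chebyshev.pi_ge N)
  have hlog : 0 < Real.log N := Real.log_pos (by linarith)
  gcongr
  have h₁ : Real.log ((N + 1) / 4) ≤ (N + 1) / 4 - 1 := Real.log_le_sub_one_of_pos (by positivity)
  rw [Real.log_div (by positivity) (by norm_num), show (4 : ℝ) = 2 ^ 2 by norm_num,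
    Real.log_pow] at h₁
  push_cast at h₁
  nlinarith [Real.log_two_gt_d9, Real.log_two_lt_d9]

theorem bi_sidon_in_interval :
    ∃ c > (0 : ℝ), ∀ N : ℕ, 2 ≤ N →
      ∃ S ⊆ Finset.Icc 1 N, IsBiSidon (S : Set ℕ) ∧
        c * (N : ℝ) ^ ((1 : ℝ) / 2) / Real.log N ≤ S.card := by
  refine ⟨1 / 340, by norm_num, fun N hN ↦ ?_⟩
  have hs : 1 ≤ N.sqrt := Nat.le_sqrt'.2 (by omega)
  obtain ⟨p, hp, hp_gt, hp_le⟩ := Nat.bertrand (N.sqrt + 1) (by omega)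
  have hM : 2 * p ^ 2 ≤ 32 * N := by
    have := Nat.sqrt_le' N
    have : p ^ 2 ≤ (4 * N.sqrt) ^ 2 := Nat.pow_le_pow_left (by omega) 2
    linarith
  have hsqrt : (N : ℝ) ^ ((1 : ℝ) / 2) ≤ p := by
    rw [← Real.sqrt_eq_rpow, Real.sqrt_le_left (by positivity)]
    have : N < (N.sqrt + 1) ^ 2 := Nat.lt_succ_sqrt' N
    have : (N.sqrt + 1) ^ 2 ≤ p ^ 2 := Nat.pow_le_pow_left hp_gt.le 2
    exact_mod_cast (by omega : N ≤ p ^ 2)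
  let f : ℕ × ℕ → ℕ := fun x ↦ x.1 + 2 * p ^ 2 - erdosTuran p x.2
  let P := Nat.primesLE N ×ˢ Finset.range p
  have hf : ∀ x ∈ P, f x ∈ Finset.range (34 * N) := by
    intro x hx
    have := Nat.le_of_mem_primesLE (Finset.mem_product.1 hx).1
    simp only [f, Finset.mem_range]
    omega
  have hcard : (Finset.range (34 * N)).card •
      (1 / 340 * (N : ℝ) ^ ((1 : ℝ) / 2) / Real.log N) ≤ P.card := by
    rw [Finset.card_product, Finset.card_range, Finset.card_range,
      Nat.primesLE_card_eq_primeCounting, nsmul_eq_mul]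
    push_cast
    have hlog : 0 ≤ (N : ℝ) / 10 / Real.log N := by positivity
    calc 34 * (N : ℝ) * (1 / 340 * (N : ℝ) ^ ((1 : ℝ) / 2) / Real.log N)
        = (N : ℝ) / 10 / Real.log N * (N : ℝ) ^ ((1 : ℝ) / 2) := by ring
      _ ≤ _ := by gcongr; exact tenth_mul_div_log_le_primeCounting hN
  obtain ⟨s, -, hs_card⟩ := Finset.exists_le_card_fiber_of_nsmul_le_card_of_maps_to hf
    ⟨0, Finset.mem_range.2 (by omega)⟩ hcard
  have hfiber : ∀ x ∈ P.filter (f · = s), x.1 ∈ Nat.primesLE N ∧ x.2 < p ∧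
      x.1 + 2 * p ^ 2 = s + erdosTuran p x.2 := by
    intro x hx
    simp only [P, f, Finset.mem_filter, Finset.mem_product, Finset.mem_range] at hx
    have := erdosTuran_lt hx.1.2
    exact ⟨hx.1.1, hx.1.2, by omega⟩
  have hinj : Set.InjOn Prod.fst (P.filter (f · = s) : Set (ℕ × ℕ)) := by
    intro x hx y hy hxy
    have h₁ := (hfiber x hx).2.2
    have h₂ := (hfiber y hy).2.2
    exact Prod.ext hxy (erdosTuran_injective hp.pos (by omega))
  refine ⟨(P.filter (f · = s)).image Prod.fst, ?_, ⟨?_, ?_⟩, ?_⟩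
  · intro q hq
    obtain ⟨x, hx, rfl⟩ := Finset.mem_image.1 hq
    have h := (hfiber x hx).1
    exact Finset.mem_Icc.2 ⟨(Nat.prime_of_mem_primesLE h).one_le, Nat.le_of_mem_primesLE h⟩
  · refine (isAddSidon_erdosTuran hp (by omega)).of_translate (m := 2 * p ^ 2) (s := s) ?_
    intro q hq
    obtain ⟨x, hx, rfl⟩ := Finset.mem_image.1 hq
    exact ⟨_, ⟨x.2, (hfiber x hx).2.1, rfl⟩, (hfiber x hx).2.2⟩
  · refine isMulSidon_of_forall_prime fun q hq ↦ ?_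
    obtain ⟨x, hx, rfl⟩ := Finset.mem_image.1 hq
    exact Nat.prime_of_mem_primesLE (hfiber x hx).1
  · rwa [Finset.card_image_of_injOn hinj]
end
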